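/- arXiv:math/0210234 — 5 statements merged into one kernel-verified Lean document; each statement's English description precedes it below -/
import Mathlib

section
/- There exists a constant η > 0 with the following property. Let û, v̂ : ℝ³ × [0,∞) → ℂ³ be jointly measurable with M := sup_{t≥0} ess sup_ξ |ξ|² |û(ξ,t)| < ∞ and N := sup_{t≥0} ess sup_ξ |ξ|² |v̂(ξ,t)| < ∞. Then for every t ≥ 0 and almost every ξ ∈ ℝ³, the convolution integrals defining Ŵ[û(·,τ),v̂(·,τ)](ξ) converge absolutely for a.e. ξ (with the pointwise bound ∫_{ℝ³} |û(ξ−z,τ)| |v̂(z,τ)| dz ≤ π³ M N / |ξ|), and |ξ|² | ∫₀ᵗ e^{−(t−τ)|ξ|²} P̂(ξ)( iξ·Ŵ[û(·,τ),v̂(·,τ)](ξ) ) dτ | ≤ η M N. -/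
open MeasureTheory Filter
open scoped ENNReal

noncomputable section

abbrev E3 : Type := EuclideanSpace ℝ (Fin 3)
abbrev V3 : Type := Fin 3 → ℂ

/-- The `PM^a` norm (on the Fourier side): `ess sup_ξ |ξ|^a |g(ξ)|`, valued in `ℝ≥0∞`. -/
def PMnorm (a : ℝ) (g : E3 → V3) : ℝ≥0∞ :=
  essSup (fun ξ : E3 => ENNReal.ofReal (‖ξ‖ ^ a * ‖g ξ‖)) volume

/-- The symbol `P̂(ξ)_{jk} = δ_{jk} − ξ_j ξ_k / |ξ|²` of the Leray projector. -/
def LerayP (ξ : E3) : Matrix (Fin 3) (Fin 3) ℂ :=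
  fun j k => (if j = k then (1 : ℂ) else 0) - ((ξ j : ℂ) * (ξ k : ℂ)) / ((‖ξ‖ : ℂ) ^ 2)

/-- The matrix-valued convolution
`Ŵ[v,w](ξ)_{jk} = (2π)^{-3/2} ∫ v_j(ξ−z) w_k(z) dz`
(the Fourier transform of the tensor product `v ⊗ w`). -/
def Wconv (v w : E3 → V3) (ξ : E3) : Matrix (Fin 3) (Fin 3) ℂ :=
  fun j k => (((2 * Real.pi) ^ ((3 : ℝ) / 2))⁻¹ : ℝ) • ∫ z : E3, v (ξ - z) j * w z k

/-- The vector `iξ·Ŵ[v,w](ξ)`, with components `Σ_k iξ_k Ŵ[v,w](ξ)_{jk}`. -/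
def ixW (v w : E3 → V3) (ξ : E3) : V3 :=
  fun j => ∑ k : Fin 3, Complex.I * (ξ k : ℂ) * Wconv v w ξ j k

/-- The Fourier side of the Navier–Stokes bilinear Duhamel term
`B(u,v)(t) = −∫₀ᵗ S(t−τ) P ∇·(u⊗v) dτ` (up to sign):
`∫₀ᵗ e^{−(t−τ)|ξ|²} P̂(ξ)( iξ·Ŵ[û(τ),v̂(τ)](ξ) ) dτ`. -/
def Bterm (u v : E3 → ℝ → V3) (ξ : E3) (t : ℝ) : V3 :=
  ∫ τ in (0 : ℝ)..t, Real.exp (-(t - τ) * ‖ξ‖ ^ 2) •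
    (LerayP ξ).mulVec (ixW (fun ζ => u ζ τ) (fun ζ => v ζ τ) ξ)

/-- The Fourier side of the Duhamel force term `∫₀ᵗ S(t−τ) P F(τ) dτ`. -/
def Fterm (F : E3 → ℝ → V3) (ξ : E3) (t : ℝ) : V3 :=
  ∫ τ in (0 : ℝ)..t, Real.exp (-(t - τ) * ‖ξ‖ ^ 2) • (LerayP ξ).mulVec (F ξ τ)

/-- `sup_{t ≥ 0} ‖u(t)‖_{PM^a}`. -/
def supPM (a : ℝ) (u : E3 → ℝ → V3) : ℝ≥0∞ :=
  ⨆ (t : ℝ) (_ : 0 ≤ t), PMnorm a (fun ξ => u ξ t)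

/-- A Fourier-side mild solution of the Navier–Stokes system with data `(û₀, F̂)`:
`û` is jointly measurable, all integrals converge absolutely, and for every `t ≥ 0`
and a.e. `ξ`,
`û(ξ,t) = e^{−t|ξ|²} û₀(ξ) − ∫₀ᵗ e^{−(t−τ)|ξ|²} P̂(ξ)(iξ·Ŵ[û(τ),û(τ)](ξ)) dτ
 + ∫₀ᵗ e^{−(t−τ)|ξ|²} P̂(ξ) F̂(ξ,τ) dτ`. -/
def IsMildSolution (u0 : E3 → V3) (F : E3 → ℝ → V3) (u : E3 → ℝ → V3) : Prop :=
  Measurable (fun p : E3 × ℝ => u p.1 p.2) ∧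
  ∀ t : ℝ, 0 ≤ t → ∀ᵐ ξ : E3,
    (∀ τ ∈ Set.Icc (0 : ℝ) t, ∀ j k : Fin 3,
        Integrable (fun z : E3 => u (ξ - z) τ j * u z τ k)) ∧
    IntervalIntegrable (fun τ : ℝ =>
        Real.exp (-(t - τ) * ‖ξ‖ ^ 2) •
          (LerayP ξ).mulVec (ixW (fun ζ => u ζ τ) (fun ζ => u ζ τ) ξ)) volume 0 t ∧
    IntervalIntegrable (fun τ : ℝ =>
        Real.exp (-(t - τ) * ‖ξ‖ ^ 2) • (LerayP ξ).mulVec (F ξ τ)) volume 0 t ∧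
    u ξ t = Real.exp (-t * ‖ξ‖ ^ 2) • u0 ξ - Bterm u u ξ t + Fterm F ξ t

/-- `η` is a constant for which the `PM²` bilinear estimate holds:
`‖B(u,v)(t)‖_{PM²} ≤ η (sup_τ ‖u(τ)‖_{PM²})(sup_τ ‖v(τ)‖_{PM²})`. -/
def BilinearEstimate (η : ℝ) : Prop :=
  ∀ u v : E3 → ℝ → V3,
    Measurable (fun p : E3 × ℝ => u p.1 p.2) →
    Measurable (fun p : E3 × ℝ => v p.1 p.2) →
    ∀ t : ℝ, 0 ≤ t →
      PMnorm 2 (fun ξ => Bterm u v ξ t) ≤ ENNReal.ofReal η * supPM 2 u * supPM 2 v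

lemma lint_exp (a : ℝ) (ha : 0 < a) :
    ∫⁻ c in Set.Ioi (0:ℝ), ENNReal.ofReal (Real.exp (-a * c)) = ENNReal.ofReal a⁻¹ := by
  rw [← ofReal_integral_eq_lintegral_ofReal (integrableOn_exp_mul_Ioi (by linarith) 0)
    (Eventually.of_forall fun c => (Real.exp_pos _).le), integral_exp_mul_Ioi (by linarith)]
  congr 1
  simp [neg_div_neg_eq]

lemma feynman (A B : ℝ) (hA : 0 < A) (hB : 0 < B) :
    ∫⁻ t in Set.Ioi (0:ℝ), ∫⁻ c in Set.Ioi (0:ℝ),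
      ENNReal.ofReal (t * Real.exp (-t * (c * A + B))) = ENNReal.ofReal (A⁻¹ * B⁻¹) := by
  have h : ∀ t ∈ Set.Ioi (0:ℝ), ∫⁻ c in Set.Ioi (0:ℝ),
      ENNReal.ofReal (t * Real.exp (-t * (c * A + B))) =
      ENNReal.ofReal A⁻¹ * ENNReal.ofReal (Real.exp (-B * t)) := by
    intro t ht
    have ht : 0 < t := ht
    have : ∀ c : ℝ, ENNReal.ofReal (t * Real.exp (-t * (c * A + B))) =
        ENNReal.ofReal (t * Real.exp (-B * t)) * ENNReal.ofReal (Real.exp (-(t * A) * c)) := by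
      intro c
      rw [← ENNReal.ofReal_mul (by positivity), mul_assoc, ← Real.exp_add]
      congr 3; ring
    simp_rw [this]
    rw [lintegral_const_mul _ (by fun_prop), lint_exp _ (by positivity),
      ← ENNReal.ofReal_mul (by positivity), ← ENNReal.ofReal_mul (by positivity)]
    congr 1; field_simp
  rw [setLIntegral_congr_fun measurableSet_Ioi h, lintegral_const_mul _ (by fun_prop),
    lint_exp _ hB, ← ENNReal.ofReal_mul (by positivity)]

lemma gauss_conv (ξ : E3) (t c : ℝ) (ht : 0 < t) (hc : 0 < c) :
    ∫⁻ z : E3, ENNReal.ofReal (t * Real.exp (-t * (c * ‖ξ - z‖ ^ 2 + ‖z‖ ^ 2))) =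
      ENNReal.ofReal (t * Real.exp (-(c / (1 + c) * ‖ξ‖ ^ 2 * t)) *
        (Real.pi / (t * (1 + c))) ^ ((3:ℝ) / 2)) := by
  have key : ∀ z : E3, c * ‖ξ - (z + (c / (1 + c)) • ξ)‖ ^ 2 + ‖z + (c / (1 + c)) • ξ‖ ^ 2
      = (1 + c) * ‖z‖ ^ 2 + c / (1 + c) * ‖ξ‖ ^ 2 := by
    intro z
    simp only [EuclideanSpace.real_norm_sq_eq, Fin.sum_univ_three, PiLp.sub_apply, PiLp.add_apply,
      PiLp.smul_apply, smul_eq_mul]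
    field_simp
    ring
  rw [← lintegral_add_right_eq_self _ ((c / (1 + c)) • ξ)]
  have hb : 0 < t * (1 + c) := by positivity
  have hI := GaussianFourier.integral_rexp_neg_mul_sq_norm (V := E3) hb
  have h2 : ∀ z : E3, ENNReal.ofReal (t * Real.exp (-t * (c * ‖ξ - (z + (c / (1 + c)) • ξ)‖ ^ 2
        + ‖z + (c / (1 + c)) • ξ‖ ^ 2))) =
      ENNReal.ofReal (t * Real.exp (-(c / (1 + c) * ‖ξ‖ ^ 2 * t))) *
        ENNReal.ofReal (Real.exp (-(t * (1 + c)) * ‖z‖ ^ 2)) := by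
    intro z
    rw [key, ← ENNReal.ofReal_mul (by positivity), mul_assoc, ← Real.exp_add]
    congr 3; ring
  simp_rw [h2]
  have hpos : 0 < (Real.pi / (t * (1 + c))) ^ ((Module.finrank ℝ E3 : ℝ) / 2) := by positivity
  rw [lintegral_const_mul _ (by fun_prop), ← ofReal_integral_eq_lintegral_ofReal
    (by by_contra h; rw [integral_undef h] at hI; exact hpos.ne hI)
    (Eventually.of_forall fun c => (Real.exp_pos _).le), hI, ← ENNReal.ofReal_mul (by positivity)]
  simp

lemma gamma_int (c X : ℝ) (hc : 0 < c) (hX : 0 < X) :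
    ∫⁻ t in Set.Ioi (0:ℝ), ENNReal.ofReal (t * Real.exp (-(c / (1 + c) * X ^ 2 * t)) *
        (Real.pi / (t * (1 + c))) ^ ((3:ℝ) / 2)) =
      ENNReal.ofReal (Real.pi ^ 2 / X) * ENNReal.ofReal (1 / ((1 + c) * √c)) := by
  have hr : 0 < c / (1 + c) * X ^ 2 := by positivity
  have h : ∀ t ∈ Set.Ioi (0:ℝ), ENNReal.ofReal (t * Real.exp (-(c / (1 + c) * X ^ 2 * t)) *
        (Real.pi / (t * (1 + c))) ^ ((3:ℝ) / 2)) =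
      ENNReal.ofReal ((Real.pi / (1 + c)) ^ ((3:ℝ) / 2)) *
        ENNReal.ofReal (t ^ ((1:ℝ) / 2 - 1) * Real.exp (-(c / (1 + c) * X ^ 2 * t))) := by
    intro t ht
    have ht : 0 < t := ht
    rw [← ENNReal.ofReal_mul (by positivity)]
    congr 1
    have e1 : Real.pi / (t * (1 + c)) = Real.pi / (1 + c) * t⁻¹ := by field_simp
    have e2 : t ^ ((1:ℝ) / 2 - 1) = t * (t⁻¹) ^ ((3:ℝ) / 2) := by
      rw [Real.inv_rpow ht.le, ← Real.rpow_neg ht.le]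
      nth_rewrite 2 [← Real.rpow_one t]
      rw [← Real.rpow_add ht]; norm_num
    rw [e1, Real.mul_rpow (by positivity) (by positivity), e2]
    ring
  have hI := Real.integral_rpow_mul_exp_neg_mul_Ioi (a := 1 / 2) (by norm_num) hr
  rw [Real.Gamma_one_half_eq] at hI
  have hpos : 0 < (1 / (c / (1 + c) * X ^ 2)) ^ ((1:ℝ) / 2) * √Real.pi := by positivity
  rw [setLIntegral_congr_fun measurableSet_Ioi h, lintegral_const_mul _ (by fun_prop),
    ← ofReal_integral_eq_lintegral_ofReal
    (by by_contra h; rw [integral_undef h] at hI; exact hpos.ne hI)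
    (by
      filter_upwards [ae_restrict_mem measurableSet_Ioi] with t ht
      have ht : 0 < t := ht
      positivity), hI, ← ENNReal.ofReal_mul (by positivity), ← ENNReal.ofReal_mul (by positivity)]
  congr 1
  have e3 : ∀ y : ℝ, 0 < y → y ^ ((3:ℝ) / 2) = y * √y := by
    intro y hy
    rw [Real.sqrt_eq_rpow]
    nth_rewrite 2 [← Real.rpow_one y]
    rw [← Real.rpow_add hy]; norm_num
  rw [e3 _ (by positivity), ← Real.sqrt_eq_rpow, Real.sqrt_div (by positivity),
    Real.sqrt_div (by positivity), Real.sqrt_mul (by positivity), Real.sqrt_div (by positivity),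
    Real.sqrt_sq hX.le, Real.sqrt_one]
  have s1 := Real.sq_sqrt Real.pi_pos.le
  have s2 := Real.sq_sqrt (show 0 ≤ 1 + c by positivity)
  have : 0 < √c := by positivity
  have : 0 < √(1 + c) := by positivity
  field_simp
  rw [s1]

lemma arctan_int :
    ∫⁻ c in Set.Ioi (0:ℝ), ENNReal.ofReal (1 / ((1 + c) * √c)) = ENNReal.ofReal Real.pi := by
  have h0 : ContinuousWithinAt (fun x => 2 * Real.arctan (√x)) (Set.Ici 0) 0 := by
    apply Continuous.continuousWithinAt
    exact continuous_const.mul (Real.continuous_arctan.comp Real.continuous_sqrt)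
  have h1 : ∀ x ∈ Set.Ioi (0:ℝ), HasDerivAt (fun x => 2 * Real.arctan (√x))
      (1 / ((1 + x) * √x)) x := by
    intro x hx
    have hx : 0 < x := hx
    refine (((Real.hasDerivAt_sqrt hx.ne').arctan).const_mul 2).congr_deriv ?_
    rw [Real.sq_sqrt hx.le]
    field_simp
  have h2 : ∀ x ∈ Set.Ioi (0:ℝ), 0 ≤ 1 / ((1 + x) * √x) := by
    intro x hx
    have hx : 0 < x := hx
    positivity
  have h3 : Tendsto (fun x => 2 * Real.arctan (√x)) atTop (nhds Real.pi) := by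
    have : Tendsto (fun x => Real.arctan (√x)) atTop (nhds (Real.pi / 2)) :=
      (Real.tendsto_arctan_atTop.mono_right nhdsWithin_le_nhds).comp Real.tendsto_sqrt_atTop
    have := this.const_mul 2
    rwa [mul_div_cancel₀ _ two_ne_zero] at this
  rw [← ofReal_integral_eq_lintegral_ofReal (integrableOn_Ioi_deriv_of_nonneg h0 h1 h2 h3)
    (by filter_upwards [ae_restrict_mem measurableSet_Ioi] with t ht using h2 t ht),
    integral_Ioi_of_hasDerivAt_of_nonneg h0 h1 h2 h3]
  simp

lemma riesz_conv (ξ : E3) (hξ : ξ ≠ 0) :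
    ∫⁻ z : E3, ENNReal.ofReal ((‖ξ - z‖ ^ 2)⁻¹ * (‖z‖ ^ 2)⁻¹) =
      ENNReal.ofReal (Real.pi ^ 3 / ‖ξ‖) := by
  have hX : 0 < ‖ξ‖ := norm_pos_iff.2 hξ
  have h1 : ∫⁻ z : E3, ENNReal.ofReal ((‖ξ - z‖ ^ 2)⁻¹ * (‖z‖ ^ 2)⁻¹) =
      ∫⁻ z : E3, ∫⁻ t in Set.Ioi (0:ℝ), ∫⁻ c in Set.Ioi (0:ℝ),
      ENNReal.ofReal (t * Real.exp (-t * (c * ‖ξ - z‖ ^ 2 + ‖z‖ ^ 2))) := by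
    apply lintegral_congr_ae
    filter_upwards [Measure.ae_ne volume (0 : E3), Measure.ae_ne volume ξ] with z hz hz'
    have a1 : 0 < ‖z‖ := norm_pos_iff.2 hz
    have a2 : 0 < ‖ξ - z‖ := norm_pos_iff.2 (sub_ne_zero.2 hz'.symm)
    rw [feynman _ _ (by positivity) (by positivity)]
  rw [h1, lintegral_lintegral_swap (by
    apply Measurable.aemeasurable
    apply Measurable.lintegral_prod_right'
      (f := fun p : (E3 × ℝ) × ℝ => ENNReal.ofReal (p.1.2 *
        Real.exp (-p.1.2 * (p.2 * ‖ξ - p.1.1‖ ^ 2 + ‖p.1.1‖ ^ 2))))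
    fun_prop)]
  have h2 : ∀ t : ℝ, ∫⁻ z : E3, ∫⁻ c in Set.Ioi (0:ℝ),
      ENNReal.ofReal (t * Real.exp (-t * (c * ‖ξ - z‖ ^ 2 + ‖z‖ ^ 2))) =
      ∫⁻ c in Set.Ioi (0:ℝ), ∫⁻ z : E3,
      ENNReal.ofReal (t * Real.exp (-t * (c * ‖ξ - z‖ ^ 2 + ‖z‖ ^ 2))) := by
    intro t
    apply lintegral_lintegral_swap
    apply Measurable.aemeasurable
    simp only [Function.uncurry_def]
    fun_prop
  simp_rw [h2]
  have h3 : ∀ t ∈ Set.Ioi (0:ℝ), ∫⁻ c in Set.Ioi (0:ℝ), ∫⁻ z : E3,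
      ENNReal.ofReal (t * Real.exp (-t * (c * ‖ξ - z‖ ^ 2 + ‖z‖ ^ 2))) =
      ∫⁻ c in Set.Ioi (0:ℝ), ENNReal.ofReal (t * Real.exp (-(c / (1 + c) * ‖ξ‖ ^ 2 * t)) *
        (Real.pi / (t * (1 + c))) ^ ((3:ℝ) / 2)) := fun t ht =>
    setLIntegral_congr_fun measurableSet_Ioi fun c hc => gauss_conv ξ t c ht hc
  rw [setLIntegral_congr_fun measurableSet_Ioi h3, lintegral_lintegral_swap (by
    apply Measurable.aemeasurable
    simp only [Function.uncurry_def]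
    fun_prop), setLIntegral_congr_fun measurableSet_Ioi fun c hc => gamma_int c ‖ξ‖ hc hX,
    lintegral_const_mul _ (by fun_prop), arctan_int, ← ENNReal.ofReal_mul (by positivity)]
  congr 1; ring

lemma ae_bound (f : E3 → V3) (m : ℝ) (hm : 0 ≤ m) (hf : PMnorm 2 f ≤ ENNReal.ofReal m) :
    ∀ᵐ x : E3, ∀ j, ‖f x j‖ ≤ m * (‖x‖ ^ 2)⁻¹ := by
  filter_upwards [ENNReal.ae_le_essSup (μ := (volume : Measure E3))
    (fun ξ : E3 => ENNReal.ofReal (‖ξ‖ ^ (2:ℝ) * ‖f ξ‖)), Measure.ae_ne volume (0 : E3)]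
    with x hx hx0 j
  have h := (ENNReal.ofReal_le_ofReal_iff hm).1 (hx.trans hf)
  have a1 : 0 < ‖x‖ := norm_pos_iff.2 hx0
  rw [Real.rpow_two] at h
  refine (norm_le_pi_norm (f x) j).trans ?_
  rw [← div_eq_mul_inv, le_div_iff₀ (by positivity)]
  linarith

lemma conv_bound (f g : E3 → V3) (m n : ℝ) (hm : 0 ≤ m) (hn : 0 ≤ n)
    (hf : PMnorm 2 f ≤ ENNReal.ofReal m) (hg : PMnorm 2 g ≤ ENNReal.ofReal n)
    (ξ : E3) (hξ : ξ ≠ 0) (j k : Fin 3) :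
    ∫⁻ z : E3, ENNReal.ofReal (‖f (ξ - z) j‖ * ‖g z k‖) ≤
      ENNReal.ofReal (Real.pi ^ 3 * m * n / ‖ξ‖) := by
  have h1 : ∀ᵐ z : E3, ∀ j, ‖f (ξ - z) j‖ ≤ m * (‖ξ - z‖ ^ 2)⁻¹ :=
    (volume.measurePreserving_sub_left ξ).quasiMeasurePreserving.ae (ae_bound f m hm hf)
  calc _ ≤ ∫⁻ z : E3, ENNReal.ofReal (m * n) *
        ENNReal.ofReal ((‖ξ - z‖ ^ 2)⁻¹ * (‖z‖ ^ 2)⁻¹) := by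
        apply lintegral_mono_ae
        filter_upwards [h1, ae_bound g n hn hg] with z h1 h2
        rw [← ENNReal.ofReal_mul (by positivity)]
        apply ENNReal.ofReal_le_ofReal
        calc _ ≤ (m * (‖ξ - z‖ ^ 2)⁻¹) * (n * (‖z‖ ^ 2)⁻¹) :=
              mul_le_mul (h1 j) (h2 k) (norm_nonneg _) (by positivity)
          _ = _ := by ring
    _ = _ := by
        rw [lintegral_const_mul _ (by fun_prop), riesz_conv ξ hξ,
          ← ENNReal.ofReal_mul (by positivity)]
        congr 1; ring

lemma W_bound (f g : E3 → V3) (m n : ℝ) (hm : 0 ≤ m) (hn : 0 ≤ n)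
    (hf : PMnorm 2 f ≤ ENNReal.ofReal m) (hg : PMnorm 2 g ≤ ENNReal.ofReal n)
    (ξ : E3) (hξ : ξ ≠ 0) (j k : Fin 3) :
    ‖Wconv f g ξ j k‖ ≤ Real.pi ^ 3 * m * n / ‖ξ‖ := by
  have h1 : ‖∫ z : E3, f (ξ - z) j * g z k‖ ≤ Real.pi ^ 3 * m * n / ‖ξ‖ := by
    refine (norm_integral_le_lintegral_norm _).trans ?_
    apply ENNReal.toReal_le_of_le_ofReal (by positivity)
    simp only [norm_mul]
    exact conv_bound f g m n hm hn hf hg ξ hξ j k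
  have h2 : ((2 * Real.pi) ^ ((3 : ℝ) / 2))⁻¹ ≤ 1 := by
    apply inv_le_one_of_one_le₀
    apply Real.one_le_rpow _ (by norm_num)
    linarith [Real.pi_gt_three]
  unfold Wconv
  rw [norm_smul, Real.norm_of_nonneg (by positivity)]
  calc _ ≤ 1 * ‖∫ z : E3, f (ξ - z) j * g z k‖ := by gcongr
    _ ≤ _ := by rw [one_mul]; exact h1

lemma ixW_bound (f g : E3 → V3) (m n : ℝ) (hm : 0 ≤ m) (hn : 0 ≤ n)
    (hf : PMnorm 2 f ≤ ENNReal.ofReal m) (hg : PMnorm 2 g ≤ ENNReal.ofReal n)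
    (ξ : E3) (hξ : ξ ≠ 0) (j : Fin 3) :
    ‖ixW f g ξ j‖ ≤ 3 * (Real.pi ^ 3 * m * n) := by
  have hX : 0 < ‖ξ‖ := norm_pos_iff.2 hξ
  unfold ixW
  calc _ ≤ ∑ k : Fin 3, (Real.pi ^ 3 * m * n) := by
        apply norm_sum_le_of_le
        intro k _
        rw [norm_mul, norm_mul, Complex.norm_I, one_mul, Complex.norm_real]
        calc _ ≤ ‖ξ‖ * (Real.pi ^ 3 * m * n / ‖ξ‖) :=
              mul_le_mul (PiLp.norm_apply_le ξ k) (W_bound f g m n hm hn hf hg ξ hξ j k)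
                (norm_nonneg _) (norm_nonneg _)
          _ = _ := by field_simp
    _ = _ := by simp

lemma leray_bound (ξ : E3) (hξ : ξ ≠ 0) (j k : Fin 3) : ‖LerayP ξ j k‖ ≤ 2 := by
  have hX : 0 < ‖ξ‖ := norm_pos_iff.2 hξ
  unfold LerayP
  refine (norm_sub_le _ _).trans ?_
  have h1 : ‖(if j = k then (1 : ℂ) else 0)‖ ≤ 1 := by split_ifs <;> simp
  have h2 : ‖((ξ j : ℂ) * (ξ k : ℂ)) / ((‖ξ‖ : ℂ) ^ 2)‖ ≤ 1 := by
    rw [norm_div, norm_mul, norm_pow, Complex.norm_real, Complex.norm_real, Complex.norm_real,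
      norm_norm, div_le_one (by positivity), sq]
    exact mul_le_mul (PiLp.norm_apply_le ξ j) (PiLp.norm_apply_le ξ k)
      (norm_nonneg _) (norm_nonneg _)
  linarith

lemma mulVec_bound (f g : E3 → V3) (m n : ℝ) (hm : 0 ≤ m) (hn : 0 ≤ n)
    (hf : PMnorm 2 f ≤ ENNReal.ofReal m) (hg : PMnorm 2 g ≤ ENNReal.ofReal n)
    (ξ : E3) (hξ : ξ ≠ 0) :
    ‖(LerayP ξ).mulVec (ixW f g ξ)‖ ≤ 18 * Real.pi ^ 3 * m * n := by
  rw [pi_norm_le_iff_of_nonneg (by positivity)]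
  intro j
  simp only [Matrix.mulVec, dotProduct]
  calc _ ≤ ∑ k : Fin 3, 2 * (3 * (Real.pi ^ 3 * m * n)) := by
        apply norm_sum_le_of_le
        intro k _
        rw [norm_mul]
        exact mul_le_mul (leray_bound ξ hξ j k) (ixW_bound f g m n hm hn hf hg ξ hξ k)
          (norm_nonneg _) (by norm_num)
    _ = _ := by simp; ring

lemma exp_int (t X : ℝ) (hX : 0 < X) :
    ∫ τ in (0:ℝ)..t, Real.exp (-(t - τ) * X) ≤ X⁻¹ := by
  have h : ∀ x ∈ Set.uIcc 0 t, HasDerivAt (fun τ => X⁻¹ * Real.exp (-(t - τ) * X))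
      (Real.exp (-(t - x) * X)) x := by
    intro x _
    have h1 : HasDerivAt (fun τ => -(t - τ) * X) X x := by
      have := (((hasDerivAt_id x).const_sub t).neg).mul_const X
      simpa using this
    refine (h1.exp.const_mul X⁻¹).congr_deriv ?_
    field_simp
  rw [intervalIntegral.integral_eq_sub_of_hasDerivAt h
    (Continuous.intervalIntegrable (by fun_prop) _ _)]
  have : 0 < X⁻¹ * Real.exp (-(t - 0) * X) := by positivity
  simp at this ⊢
  linarith

/-- **Continuity of the Navier–Stokes bilinear form on `C_w([0,∞), PM²)`:**
there is `η > 0` such that for jointly measurable `û, v̂` with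
`M = sup_{t≥0}‖û(t)‖_{PM²} < ∞`, `N = sup_{t≥0}‖v̂(t)‖_{PM²} < ∞`, the convolution
integrals defining `Ŵ[û(τ),v̂(τ)](ξ)` converge absolutely for a.e. `ξ`, with
`∫ |û(ξ−z,τ)||v̂(z,τ)| dz ≤ π³ M N / |ξ|`, and
`|ξ|² |∫₀ᵗ e^{−(t−τ)|ξ|²} P̂(ξ)(iξ·Ŵ[û(τ),v̂(τ)](ξ)) dτ| ≤ η M N`. -/
theorem bilinear_form_continuous_PM2 :
    ∃ η : ℝ, 0 < η ∧
      ∀ u v : E3 → ℝ → V3,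
        Measurable (fun p : E3 × ℝ => u p.1 p.2) →
        Measurable (fun p : E3 × ℝ => v p.1 p.2) →
        supPM 2 u ≠ ⊤ → supPM 2 v ≠ ⊤ →
        (∀ τ : ℝ, 0 ≤ τ → ∀ᵐ ξ : E3, ∀ j k : Fin 3,
            ∫⁻ z : E3, ENNReal.ofReal (‖u (ξ - z) τ j‖ * ‖v z τ k‖) ≤
              ENNReal.ofReal (Real.pi ^ 3) * supPM 2 u * supPM 2 v /
                ENNReal.ofReal ‖ξ‖) ∧
        (∀ t : ℝ, 0 ≤ t →
            PMnorm 2 (fun ξ => Bterm u v ξ t) ≤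
              ENNReal.ofReal η * supPM 2 u * supPM 2 v) := by
  refine ⟨18 * Real.pi ^ 3, by positivity, ?_⟩
  intro u v _ _ hu hv
  have hM : supPM 2 u = ENNReal.ofReal (supPM 2 u).toReal := (ENNReal.ofReal_toReal hu).symm
  have hN : supPM 2 v = ENNReal.ofReal (supPM 2 v).toReal := (ENNReal.ofReal_toReal hv).symm
  have hm : 0 ≤ (supPM 2 u).toReal := ENNReal.toReal_nonneg
  have hn : 0 ≤ (supPM 2 v).toReal := ENNReal.toReal_nonneg
  have hu' : ∀ τ : ℝ, 0 ≤ τ → PMnorm 2 (fun ξ => u ξ τ) ≤ supPM 2 u := fun τ hτ =>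
    le_iSup₂ (f := fun (t : ℝ) (_ : 0 ≤ t) => PMnorm 2 (fun ξ => u ξ t)) τ hτ
  have hv' : ∀ τ : ℝ, 0 ≤ τ → PMnorm 2 (fun ξ => v ξ τ) ≤ supPM 2 v := fun τ hτ =>
    le_iSup₂ (f := fun (t : ℝ) (_ : 0 ≤ t) => PMnorm 2 (fun ξ => v ξ t)) τ hτ
  generalize (supPM 2 u).toReal = m at *
  generalize (supPM 2 v).toReal = n at *
  rw [hM] at hu' ⊢
  rw [hN] at hv' ⊢
  constructor
  · intro τ hτ
    filter_upwards [Measure.ae_ne volume (0 : E3)] with ξ hξ j k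
    have hX : 0 < ‖ξ‖ := norm_pos_iff.2 hξ
    refine (conv_bound _ _ m n hm hn (hu' τ hτ) (hv' τ hτ) ξ hξ j k).trans ?_
    rw [← ENNReal.ofReal_mul (by positivity), ← ENNReal.ofReal_mul (by positivity),
      ← ENNReal.ofReal_div_of_pos hX]
  · intro t ht
    rw [← ENNReal.ofReal_mul (by positivity), ← ENNReal.ofReal_mul (by positivity)]
    refine essSup_le_of_ae_le _ ?_
    filter_upwards [Measure.ae_ne volume (0 : E3)] with ξ hξ
    have hX : 0 < ‖ξ‖ := norm_pos_iff.2 hξ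
    apply ENNReal.ofReal_le_ofReal
    rw [Real.rpow_two]
    have hB : ‖Bterm u v ξ t‖ ≤ 18 * Real.pi ^ 3 * m * n * (‖ξ‖ ^ 2)⁻¹ := by
      unfold Bterm
      refine (intervalIntegral.norm_integral_le_of_norm_le
        (g := fun τ => 18 * Real.pi ^ 3 * m * n * Real.exp (-(t - τ) * ‖ξ‖ ^ 2)) ht ?_ ?_).trans ?_
      · refine Eventually.of_forall fun τ hτ => ?_
        rw [norm_smul, Real.norm_of_nonneg (Real.exp_pos _).le, mul_comm]
        exact mul_le_mul_of_nonneg_right (mulVec_bound _ _ m n hm hn (hu' τ hτ.1.le)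
          (hv' τ hτ.1.le) ξ hξ) (Real.exp_pos _).le
      · exact Continuous.intervalIntegrable (by fun_prop) _ _
      · rw [intervalIntegral.integral_const_mul]
        exact mul_le_mul_of_nonneg_left (exp_int t _ (by positivity)) (by positivity)
    calc _ ≤ ‖ξ‖ ^ 2 * (18 * Real.pi ^ 3 * m * n * (‖ξ‖ ^ 2)⁻¹) := by gcongr
      _ = _ := by field_simp
end
end

section
/- Let η > 0 be a constant for which the bilinear estimate holds, and let F̂ : ℝ³ → ℂ³ be measurable with ess sup_ξ |F̂(ξ)| < ε for some 0 < ε < 1/(4η). Then there exists a measurable û_∞ : ℝ³ → ℂ³ with ess sup_ξ |ξ|² |û_∞(ξ)| ≤ 2ε such that for almost every ξ ≠ 0, û_∞(ξ) = (1/|ξ|²)( −P̂(ξ)( iξ·Ŵ[û_∞,û_∞](ξ) ) + P̂(ξ) F̂(ξ) ), the convolution converging absolutely; moreover û_∞ is the unique such solution satisfying ess sup_ξ |ξ|² |û_∞(ξ)| ≤ 2ε. -/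
open MeasureTheory Filter
open scoped ENNReal

noncomputable section

/-- The Fourier side of the stationary Navier–Stokes integral equation
`u = −∫₀^∞ S(τ)P∇·(u⊗u)dτ + ∫₀^∞ S(τ)PF dτ`, i.e.
`û(ξ) = |ξ|^{−2}( −P̂(ξ)(iξ·Ŵ[û,û](ξ)) + P̂(ξ)F̂(ξ) )` for a.e. `ξ ≠ 0`. -/
def IsStationarySolution (F u : E3 → V3) : Prop :=
  ∀ᵐ ξ : E3, ξ ≠ 0 →
    u ξ = ((‖ξ‖ : ℝ) ^ 2)⁻¹ •
      (-(LerayP ξ).mulVec (ixW u u ξ) + (LerayP ξ).mulVec (F ξ))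

/-- `η` is a constant for which the stationary `PM²` bilinear estimate
`‖∫₀^∞ S(τ)P∇·(u⊗v)dτ‖_{PM²} ≤ η ‖u‖_{PM²} ‖v‖_{PM²}` holds on the Fourier side
(including absolute convergence of the convolutions). -/
def StationaryBilinearEstimate (η : ℝ) : Prop :=
  ∀ u v : E3 → V3, Measurable u → Measurable v →
    PMnorm 2 u ≠ ⊤ → PMnorm 2 v ≠ ⊤ →
    (∀ᵐ ξ : E3, ∀ j k : Fin 3, Integrable (fun z : E3 => u (ξ - z) j * v z k)) ∧
    PMnorm 0 (fun ξ => (LerayP ξ).mulVec (ixW u v ξ)) ≤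
      ENNReal.ofReal η * PMnorm 2 u * PMnorm 2 v


/-- The scalar kernel integral. -/
def KI (ξ : E3) : ℝ := ∫ z : E3, (‖ξ - z‖ ^ 2)⁻¹ * (‖z‖ ^ 2)⁻¹

lemma KI_rot (x y : E3) (h : ‖x‖ = ‖y‖) : KI x = KI y := by
  set R := Submodule.reflection (Submodule.span ℝ {x - y})ᗮ with hR
  have hRx : R x = y := Submodule.reflection_sub h
  have hm := R.measurePreserving
  have := hm.integral_comp R.toHomeomorph.measurableEmbedding
    (fun z : E3 => (‖y - z‖ ^ 2)⁻¹ * (‖z‖ ^ 2)⁻¹)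
  unfold KI
  rw [← this]
  congr 1
  ext z
  rw [← hRx, ← map_sub, R.norm_map, R.norm_map]

lemma KI_smul (r : ℝ) (hr : 0 < r) (x : E3) : KI (r • x) = r⁻¹ * KI x := by
  have := Measure.integral_comp_smul (volume : Measure E3)
    (fun z : E3 => (‖r • x - z‖ ^ 2)⁻¹ * (‖z‖ ^ 2)⁻¹) r
  have h2 : ∀ z : E3, (‖r • x - r • z‖ ^ 2)⁻¹ * (‖r • z‖ ^ 2)⁻¹
      = (r ^ 4)⁻¹ * ((‖x - z‖ ^ 2)⁻¹ * (‖z‖ ^ 2)⁻¹) := by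
    intro z
    rw [← smul_sub, norm_smul, norm_smul, Real.norm_of_nonneg hr.le]
    rw [mul_pow, mul_pow, mul_inv, mul_inv]
    have : (r ^ 4)⁻¹ = (r^2)⁻¹ * (r^2)⁻¹ := by rw [← mul_inv]; ring_nf
    rw [this]; ring
  simp only [h2] at this
  rw [integral_const_mul] at this
  simp only [finrank_euclideanSpace, Fintype.card_fin, smul_eq_mul] at this
  rw [abs_of_pos (by positivity)] at this
  unfold KI
  field_simp at this ⊢
  linarith

/-- A fixed unit vector. -/
def e0 : E3 := EuclideanSpace.single 0 1

lemma KI_eq (x : E3) (hx : x ≠ 0) : KI x = ‖x‖⁻¹ * KI e0 := by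
  have hn : 0 < ‖x‖ := norm_pos_iff.2 hx
  rw [← KI_smul _ hn]
  apply KI_rot
  simp [norm_smul, e0]

lemma KI_nonneg (x : E3) : 0 ≤ KI x := integral_nonneg fun z => by positivity

/-- The constant `K`. -/
def KK : ℝ := ((2 * Real.pi) ^ ((3 : ℝ) / 2))⁻¹ * KI e0

lemma KK_nonneg : 0 ≤ KK := mul_nonneg (by positivity) (KI_nonneg _)

/-- test functions -/
def tf (s : V3) : E3 → V3 := fun z => ((‖z‖ ^ 2)⁻¹ : ℝ) • s

lemma tf_meas (s : V3) : Measurable (tf s) := by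
  unfold tf; fun_prop

lemma tf_norm (s : V3) (hs : ‖s‖ ≤ 1) : PMnorm 2 (tf s) ≤ 1 := by
  unfold PMnorm
  refine essSup_le_of_ae_le _ (ae_of_all _ fun z => ?_)
  simp only [tf, norm_smul]
  rw [ENNReal.ofReal_le_one]
  by_cases hz : z = 0
  · simp [hz]
  have : 0 < ‖z‖ := norm_pos_iff.2 hz
  rw [Real.rpow_two, Real.norm_of_nonneg (by positivity), ← mul_assoc,
    mul_inv_cancel₀ (by positivity), one_mul]
  exact hs

lemma Wconv_tf (s t : V3) (ξ : E3) (hξ : ξ ≠ 0) (j k : Fin 3) :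
    Wconv (tf s) (tf t) ξ j k = ((KK * ‖ξ‖⁻¹ : ℝ) : ℂ) * (s j * t k) := by
  have h : ∀ z, tf s (ξ - z) j * tf t z k
      = (((‖ξ - z‖ ^ 2)⁻¹ * (‖z‖ ^ 2)⁻¹ : ℝ) : ℂ) * (s j * t k) := by
    intro z
    simp only [tf, Pi.smul_apply, Complex.real_smul]
    push_cast
    ring
  unfold Wconv
  simp only [h]
  rw [integral_mul_const, integral_complex_ofReal]
  change _ • ((KI ξ : ℂ) * _) = _
  rw [KI_eq ξ hξ, Complex.real_smul, KK]
  push_cast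
  ring

lemma eta_bound (η : ℝ) (hη : 0 < η) (hB : StationaryBilinearEstimate η) :
    4 * KK ≤ Real.sqrt 3 * η := by
  set s : V3 := ![1, -1, -1] with hs
  set t : V3 := ![1, 1, 1] with ht
  have hs1 : ‖s‖ ≤ 1 := by
    rw [pi_norm_le_iff_of_nonneg zero_le_one]; intro i; fin_cases i <;> simp [hs]
  have ht1 : ‖t‖ ≤ 1 := by
    rw [pi_norm_le_iff_of_nonneg zero_le_one]; intro i; fin_cases i <;> simp [ht]
  have hsn := tf_norm s hs1
  have htn := tf_norm t ht1
  have h := (hB (tf s) (tf t) (tf_meas s) (tf_meas t) (ne_top_of_le_ne_top (by simp) hsn)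
    (ne_top_of_le_ne_top (by simp) htn)).2
  have h1 : PMnorm 0 (fun ξ => (LerayP ξ).mulVec (ixW (tf s) (tf t) ξ)) ≤ ENNReal.ofReal η := by
    refine h.trans ?_
    calc _ ≤ ENNReal.ofReal η * 1 * 1 := by gcongr
      _ = _ := by simp
  -- the real function
  set φ : E3 → ℝ := fun ξ => KK * ‖ξ‖⁻¹ * (ξ 0 + ξ 1 + ξ 2) *
    (1 - ξ 0 * (ξ 0 - ξ 1 - ξ 2) / ‖ξ‖ ^ 2) with hφ
  have h2 : ∀ᵐ ξ : E3, ξ ≠ 0 → φ ξ ≤ η := by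
    filter_upwards [ENNReal.ae_le_essSup (μ := volume) (fun ξ : E3 => ENNReal.ofReal
      (‖ξ‖ ^ (0:ℝ) * ‖(LerayP ξ).mulVec (ixW (tf s) (tf t) ξ)‖))] with ξ hξ h0
    have h3 := hξ.trans h1
    rw [ENNReal.ofReal_le_ofReal_iff hη.le, Real.rpow_zero, one_mul] at h3
    have h4 := (norm_le_pi_norm ((LerayP ξ).mulVec (ixW (tf s) (tf t) ξ)) 0).trans h3
    have h5 : (LerayP ξ).mulVec (ixW (tf s) (tf t) ξ) 0 = Complex.I * ((φ ξ : ℝ) : ℂ) := by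
      simp only [Matrix.mulVec, dotProduct, ixW, Wconv_tf s t ξ h0, Fin.sum_univ_three, LerayP, hφ]
      simp [hs, ht]
      ring
    rw [h5, norm_mul, Complex.norm_I, one_mul, Complex.norm_real] at h4
    exact (le_abs_self _).trans h4
  set p : E3 := !₂[1, 1, 1] with hp
  have hpn : ‖p‖ = Real.sqrt 3 := by
    rw [EuclideanSpace.norm_eq]; simp [hp, Fin.sum_univ_three]; norm_num
  have hp0 : p ≠ 0 := by
    rw [← norm_pos_iff, hpn]; positivity
  have hc : ContinuousAt φ p := by
    have : ‖p‖ ≠ 0 := norm_ne_zero_iff.2 hp0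
    have h2 : ‖p‖ ^ 2 ≠ 0 := pow_ne_zero _ this
    simp only [hφ]
    fun_prop (disch := assumption)
  have h3 : φ p ≤ η := by
    by_contra hcon
    push Not at hcon
    have hev : ∀ᶠ ξ in nhds p, η < φ ξ ∧ ξ ≠ 0 :=
      (hc.eventually (lt_mem_nhds hcon)).and (isOpen_ne.mem_nhds hp0)
    have hd := Measure.dense_of_ae h2
    obtain ⟨ξ, h6, h7⟩ := (hd.inter_nhds_nonempty hev)
    exact absurd (h6 h7.2) (not_le.2 h7.1)
  have h4 : φ p = KK * (Real.sqrt 3)⁻¹ * 4 := by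
    simp only [hφ, hpn]
    rw [Real.sq_sqrt (by norm_num)]
    simp [hp]
    ring
  rw [h4] at h3
  have h5 : 0 < Real.sqrt 3 := by positivity
  field_simp at h3
  linarith

abbrev H3 : Type := EuclideanSpace ℂ (Fin 3)

/-- View a vector in the Euclidean space. -/
abbrev toH (a : V3) : H3 := WithLp.toLp 2 a

lemma norm_le_toH (a : V3) : ‖a‖ ≤ ‖toH a‖ := by
  rw [pi_norm_le_iff_of_nonneg (norm_nonneg _)]
  intro i
  exact PiLp.norm_apply_le (toH a) i

lemma toH_le (a : V3) : ‖toH a‖ ≤ Real.sqrt 3 * ‖a‖ := by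
  rw [EuclideanSpace.norm_eq]
  apply Real.sqrt_le_iff.2
  refine ⟨by positivity, ?_⟩
  rw [mul_pow, Real.sq_sqrt (by norm_num)]
  have h : ∀ i, ‖a i‖ ^ 2 ≤ ‖a‖ ^ 2 := fun i => by
    have := norm_le_pi_norm a i
    gcongr
  simp only [Fin.sum_univ_three]
  have h0 := h 0
  have h1 := h 1
  have h2 := h 2
  linarith

lemma proj_norm_le (N a : H3) (hN : ‖N‖ = 1) : ‖a - (inner ℂ N a) • N‖ ≤ ‖a‖ := by
  have h : inner ℂ (a - (inner ℂ N a) • N) ((inner ℂ N a) • N) = 0 := by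
    rw [inner_smul_right, inner_sub_left, inner_smul_left, inner_self_eq_norm_sq_to_K, hN]
    simp
  have h2 := norm_add_sq_eq_norm_sq_add_norm_sq_of_inner_eq_zero _ _ h
  rw [sub_add_cancel] at h2
  nlinarith [norm_nonneg (a - (inner ℂ N a) • N), norm_nonneg a, norm_nonneg ((inner ℂ N a) • N)]

lemma sq_norm_E3 (ξ : E3) : ‖ξ‖ ^ 2 = ξ 0 ^ 2 + ξ 1 ^ 2 + ξ 2 ^ 2 := by
  rw [EuclideanSpace.norm_sq_eq]; simp [Fin.sum_univ_three]

/-- complexification -/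
def cx (ξ : E3) : H3 := toH (fun k => (ξ k : ℂ))

lemma cx_norm (ξ : E3) : ‖cx ξ‖ = ‖ξ‖ := by
  simp [cx, EuclideanSpace.norm_eq]

lemma inner_cx (ξ : E3) (a : V3) : inner ℂ (cx ξ) (toH a) = ∑ k, (ξ k : ℂ) * a k := by
  simp [cx, PiLp.inner_apply, mul_comm]

lemma leray_norm (ξ : E3) (hξ : ξ ≠ 0) (a : V3) : ‖toH ((LerayP ξ).mulVec a)‖ ≤ ‖toH a‖ := by
  have hn : 0 < ‖ξ‖ := norm_pos_iff.2 hξ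
  have hnc : (‖ξ‖ : ℂ) ≠ 0 := by exact_mod_cast hn.ne'
  set N : H3 := ((‖ξ‖⁻¹ : ℝ) : ℂ) • cx ξ with hN
  have hN1 : ‖N‖ = 1 := by
    rw [hN, norm_smul, cx_norm, Complex.norm_real, norm_inv, norm_norm, inv_mul_cancel₀ hn.ne']
  have h : toH ((LerayP ξ).mulVec a) = toH a - (inner ℂ N (toH a)) • N := by
    rw [hN, inner_smul_left, inner_cx]
    ext j
    simp only [Matrix.mulVec, dotProduct, LerayP, cx, PiLp.sub_apply, PiLp.smul_apply, smul_eq_mul,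
      sub_mul, Finset.sum_sub_distrib, ite_mul, one_mul, zero_mul, Finset.sum_ite_eq,
      Finset.mem_univ, if_true, Fin.sum_univ_three, Complex.conj_ofReal]
    push_cast
    field_simp
  rw [h]
  exact proj_norm_le N _ hN1

lemma leray_sup (ξ : E3) (hξ : ξ ≠ 0) (a : V3) :
    ‖(LerayP ξ).mulVec a‖ ≤ 7 / 5 * ‖a‖ := by
  rw [pi_norm_le_iff_of_nonneg (by positivity)]
  intro j
  have hn : 0 < ‖ξ‖ := norm_pos_iff.2 hξ
  have hs := sq_norm_E3 ξ
  have key : ∑ k, ‖LerayP ξ j k‖ ≤ 7 / 5 := by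
    have e : ∀ k, LerayP ξ j k = (((if j = k then (1 : ℝ) else 0) - ξ j * ξ k / ‖ξ‖ ^ 2 : ℝ) : ℂ) := by
      intro k; simp only [LerayP]; push_cast; split_ifs <;> simp
    simp only [e, Complex.norm_real, Fin.sum_univ_three]
    have aux : ∀ a b c n : ℝ, 0 < n → n ^ 2 = a ^ 2 + b ^ 2 + c ^ 2 →
        |1 - a * a / n ^ 2| + |0 - a * b / n ^ 2| + |0 - a * c / n ^ 2| ≤ 7 / 5 := by
      intro a b c n hn h
      have h1 : |1 - a * a / n ^ 2| = (b ^ 2 + c ^ 2) / n ^ 2 := by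
        rw [show 1 - a * a / n ^ 2 = (b ^ 2 + c ^ 2) / n ^ 2 by field_simp; linarith]
        exact abs_of_nonneg (by positivity)
      rw [h1, zero_sub, zero_sub, abs_neg, abs_neg, abs_div, abs_div, abs_mul, abs_mul,
        abs_of_pos (pow_pos hn 2), ← add_div, ← add_div, div_le_iff₀ (by positivity), h]
      nlinarith [sq_nonneg (7 * |a| - 5 * |b|), sq_nonneg (7 * |a| - 5 * |c|), sq_abs a, sq_abs b,
        sq_abs c, sq_nonneg b, sq_nonneg c, sq_nonneg a]
    fin_cases j
    · have := aux (ξ 0) (ξ 1) (ξ 2) _ hn hs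
      simp [abs_mul, abs_div] at this ⊢; linarith
    · have := aux (ξ 1) (ξ 0) (ξ 2) _ hn (by linarith)
      simp [abs_mul, abs_div] at this ⊢; linarith
    · have := aux (ξ 2) (ξ 0) (ξ 1) _ hn (by linarith)
      simp [abs_mul, abs_div] at this ⊢; linarith
  calc ‖(LerayP ξ).mulVec a j‖ ≤ ∑ k, ‖LerayP ξ j k * a k‖ := by
        simp only [Matrix.mulVec, dotProduct]; exact norm_sum_le _ _
    _ ≤ ∑ k, ‖LerayP ξ j k‖ * ‖a‖ := by
        refine Finset.sum_le_sum fun k _ => ?_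
        rw [norm_mul]
        have := norm_le_pi_norm a k
        gcongr
    _ = (∑ k, ‖LerayP ξ j k‖) * ‖a‖ := by rw [Finset.sum_mul]
    _ ≤ _ := by gcongr

/-- finite PM² norm in Euclidean sense -/
def Bd (A : ℝ) (u : E3 → V3) : Prop := ∀ᵐ z : E3, ‖toH (u z)‖ ≤ A * (‖z‖ ^ 2)⁻¹

lemma Bd.pm {A : ℝ} {u : E3 → V3} (h : Bd A u) : PMnorm 2 u ≠ ⊤ := by
  refine ne_top_of_le_ne_top (b := ENNReal.ofReal |A|) (by simp) ?_
  refine essSup_le_of_ae_le _ ?_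
  filter_upwards [h] with z hz
  apply ENNReal.ofReal_le_ofReal
  rw [Real.rpow_two]
  by_cases h0 : z = 0
  · simp [h0]
  have hn : 0 < ‖z‖ := norm_pos_iff.2 h0
  calc ‖z‖ ^ 2 * ‖u z‖ ≤ ‖z‖ ^ 2 * (A * (‖z‖ ^ 2)⁻¹) := by
        gcongr; exact (norm_le_toH _).trans hz
    _ = A := by field_simp
    _ ≤ _ := le_abs_self _

lemma kernel_int (η : ℝ) (hB : StationaryBilinearEstimate η) :
    ∀ᵐ ξ : E3, Integrable (fun z : E3 => (‖ξ - z‖ ^ 2)⁻¹ * (‖z‖ ^ 2)⁻¹) := by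
  have hs1 : ‖(1 : V3)‖ ≤ 1 := by simp
  have h := (hB (tf 1) (tf 1) (tf_meas _) (tf_meas _)
    (ne_top_of_le_ne_top (by simp) (tf_norm 1 hs1))
    (ne_top_of_le_ne_top (by simp) (tf_norm 1 hs1))).1
  filter_upwards [h] with ξ hξ
  have := (hξ 0 0).re
  refine this.congr (ae_of_all _ fun z => ?_)
  simp only [tf, Pi.smul_apply, Pi.one_apply, Complex.real_smul, mul_one]
  rw [← Complex.ofReal_mul]
  exact Complex.ofReal_re _

lemma main_est (η : ℝ) (hB : StationaryBilinearEstimate η) (u v : E3 → V3)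
    (hu : Measurable u) (hv : Measurable v) (A B : ℝ) (hA : 0 ≤ A)
    (huA : Bd A u) (hvB : Bd B v) :
    ∀ᵐ ξ : E3, ‖toH ((LerayP ξ).mulVec (ixW u v ξ))‖ ≤ KK * A * B := by
  have h0 : ∀ᵐ ξ : E3, ξ ≠ 0 := by
    simp [ae_iff]
  filter_upwards [h0, kernel_int η hB, (hB u v hu hv huA.pm hvB.pm).1] with ξ hξ hk hI
  have hn : 0 < ‖ξ‖ := norm_pos_iff.2 hξ
  refine (leray_norm ξ hξ _).trans ?_
  set c : ℝ := ((2 * Real.pi) ^ ((3 : ℝ) / 2))⁻¹ with hc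
  have hc0 : 0 ≤ c := by positivity
  set g : E3 → H3 := fun z => (Complex.I * inner ℂ (cx ξ) (toH (v z))) • toH (u (ξ - z)) with hg
  have hgj : ∀ z j, g z j = ∑ k, Complex.I * (ξ k : ℂ) * (u (ξ - z) j * v z k) := by
    intro z j
    simp only [hg, inner_cx, PiLp.smul_apply, smul_eq_mul, Finset.mul_sum, Finset.sum_mul]
    refine Finset.sum_congr rfl fun k _ => ?_
    ring
  have hgi : ∀ j, Integrable (fun z => g z j) := by
    intro j
    simp only [hgj]
    exact integrable_finsetSum _ fun k _ => (hI j k).const_mul _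
  have hix : toH (ixW u v ξ) = c • ∫ z, g z := by
    ext j
    rw [PiLp.smul_apply, eval_integral_piLp hgi]
    simp only [hgj]
    rw [integral_finsetSum _ fun k _ => (hI j k).const_mul _]
    simp only [integral_const_mul, ixW, Wconv, Finset.smul_sum]
    refine Finset.sum_congr rfl fun k _ => ?_
    rw [mul_smul_comm]
  have hsub : ∀ᵐ z : E3, ‖toH (u (ξ - z))‖ ≤ A * (‖ξ - z‖ ^ 2)⁻¹ :=
    (Measure.measurePreserving_sub_left volume ξ).quasiMeasurePreserving.ae huA
  have hint : ‖∫ z, g z‖ ≤ ∫ z : E3, (‖ξ‖ * A * B) * ((‖ξ - z‖ ^ 2)⁻¹ * (‖z‖ ^ 2)⁻¹) := by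
    refine norm_integral_le_of_norm_le (hk.const_mul _) ?_
    filter_upwards [hsub, hvB] with z hz1 hz2
    rw [hg, norm_smul, norm_mul, Complex.norm_I, one_mul]
    calc _ ≤ (‖ξ‖ * (B * (‖z‖ ^ 2)⁻¹)) * (A * (‖ξ - z‖ ^ 2)⁻¹) := by
          have h1 := norm_inner_le_norm (𝕜 := ℂ) (cx ξ) (toH (v z))
          rw [cx_norm] at h1
          have h2 : ‖inner ℂ (cx ξ) (toH (v z))‖ ≤ ‖ξ‖ * (B * (‖z‖ ^ 2)⁻¹) :=
            h1.trans (by gcongr)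
          exact mul_le_mul h2 hz1 (norm_nonneg _) ((norm_nonneg _).trans h2)
      _ = _ := by ring
  rw [integral_const_mul] at hint
  change _ ≤ _ * KI ξ at hint
  rw [KI_eq ξ hξ] at hint
  rw [hix, norm_smul, Real.norm_of_nonneg hc0]
  calc _ ≤ c * (‖ξ‖ * A * B * (‖ξ‖⁻¹ * KI e0)) := by gcongr
    _ = KK * A * B := by rw [KK, ← hc]; field_simp

lemma diff_eq (η : ℝ) (hB : StationaryBilinearEstimate η) (u v : E3 → V3)
    (hu : Measurable u) (hv : Measurable v) (huA : PMnorm 2 u ≠ ⊤) (hvB : PMnorm 2 v ≠ ⊤) :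
    ∀ᵐ ξ : E3, (LerayP ξ).mulVec (ixW u u ξ) - (LerayP ξ).mulVec (ixW v v ξ) =
      (LerayP ξ).mulVec (ixW (u - v) u ξ) + (LerayP ξ).mulVec (ixW v (u - v) ξ) := by
  filter_upwards [(hB u u hu hu huA huA).1, (hB v v hv hv hvB hvB).1,
    (hB v u hv hu hvB huA).1] with ξ h1 h2 h3
  rw [← Matrix.mulVec_sub, ← Matrix.mulVec_add]
  congr 1
  ext j
  simp only [Pi.sub_apply, Pi.add_apply, ixW, ← Finset.sum_sub_distrib, ← Finset.sum_add_distrib]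
  refine Finset.sum_congr rfl fun k _ => ?_
  simp only [Wconv, Pi.sub_apply, sub_mul, mul_sub]
  rw [integral_sub (h1 j k) (h3 j k), integral_sub (h3 j k) (h2 j k), smul_sub, smul_sub]
  ring

lemma ixW_meas (u v : E3 → V3) (hu : Measurable u) (hv : Measurable v) :
    Measurable (fun ξ => (LerayP ξ).mulVec (ixW u v ξ)) := by
  have hW : ∀ j k, Measurable (fun ξ => Wconv u v ξ j k) := by
    intro j k
    unfold Wconv
    refine Measurable.const_smul (g := fun ξ : E3 => ∫ z : E3, u (ξ - z) j * v z k) ?_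
      (((2 * Real.pi) ^ ((3 : ℝ) / 2))⁻¹ : ℝ)
    refine (StronglyMeasurable.integral_prod_right (f := fun (ξ z : E3) => u (ξ - z) j * v z k)
      ?_).measurable
    apply Measurable.stronglyMeasurable
    have h1 : Measurable fun p : E3 × E3 => u (p.1 - p.2) j :=
      (measurable_pi_apply j).comp (hu.comp (measurable_fst.sub measurable_snd))
    have h2 : Measurable fun p : E3 × E3 => v p.2 k :=
      (measurable_pi_apply k).comp (hv.comp measurable_snd)
    exact h1.mul h2
  have hx : ∀ k, Measurable (fun ξ : E3 => (ξ k : ℂ)) := fun k => by fun_prop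
  refine measurable_pi_lambda _ fun j => ?_
  simp only [Matrix.mulVec, dotProduct, ixW, LerayP]
  fun_prop

lemma leray_meas (u : E3 → V3) (hu : Measurable u) :
    Measurable (fun ξ => (LerayP ξ).mulVec (u ξ)) := by
  have hx : ∀ k, Measurable (fun ξ : E3 => (ξ k : ℂ)) := fun k => by fun_prop
  refine measurable_pi_lambda _ fun j => ?_
  simp only [Matrix.mulVec, dotProduct, LerayP]
  fun_prop

abbrev XL : Type := Lp H3 ⊤ (volume : Measure E3)

/-- The Fourier-side function attached to `f`. -/
def uf (f : XL) : E3 → V3 := fun ξ => ((‖ξ‖ ^ 2)⁻¹ : ℝ) • (f ξ).ofLp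

lemma uf_meas (f : XL) : Measurable (uf f) := by
  have h := (Lp.stronglyMeasurable f).measurable
  have h2 : Measurable fun ξ => (f ξ).ofLp := (WithLp.measurable_ofLp 2 _).comp h
  unfold uf
  fun_prop

lemma XL_ae (f : XL) : ∀ᵐ ξ : E3, ‖f ξ‖ ≤ ‖f‖ := by
  filter_upwards [enorm_ae_le_eLpNormEssSup f volume] with ξ hξ
  rw [Lp.norm_def, eLpNorm_exponent_top, ← toReal_enorm]
  refine ENNReal.toReal_mono ?_ hξ
  have := Lp.eLpNorm_ne_top f
  rwa [eLpNorm_exponent_top] at this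

lemma XL_norm_le (f : XL) (C : ℝ) (hC : 0 ≤ C) (h : ∀ᵐ ξ : E3, ‖f ξ‖ ≤ C) : ‖f‖ ≤ C := by
  rw [Lp.norm_def, eLpNorm_exponent_top]
  exact ENNReal.toReal_le_of_le_ofReal hC (eLpNormEssSup_le_of_ae_bound h)

lemma uf_toH (f : XL) (ξ : E3) : toH (uf f ξ) = ((‖ξ‖ ^ 2)⁻¹ : ℝ) • f ξ := rfl

lemma uf_bd (f : XL) : Bd ‖f‖ (uf f) := by
  filter_upwards [XL_ae f] with ξ hξ
  rw [uf_toH, norm_smul, Real.norm_of_nonneg (by positivity), mul_comm]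
  gcongr

lemma uf_sub_bd (f g : XL) : Bd ‖f - g‖ (uf f - uf g) := by
  filter_upwards [XL_ae (f - g), Lp.coeFn_sub f g] with ξ hξ h2
  have : toH ((uf f - uf g) ξ) = ((‖ξ‖ ^ 2)⁻¹ : ℝ) • (f - g : XL) ξ := by
    rw [h2, Pi.sub_apply, Pi.sub_apply, smul_sub]; rfl
  rw [this, norm_smul, Real.norm_of_nonneg (by positivity), mul_comm]
  gcongr

/-- The nonlinear map, pointwise. -/
def GG (F u : E3 → V3) : E3 → H3 := fun ξ =>
  toH (-(LerayP ξ).mulVec (ixW u u ξ) + (LerayP ξ).mulVec (F ξ))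

lemma GG_meas (F u : E3 → V3) (hF : Measurable F) (hu : Measurable u) :
    AEStronglyMeasurable (GG F u) (volume : Measure E3) := by
  have h : Measurable fun ξ => (-(LerayP ξ).mulVec (ixW u u ξ) + (LerayP ξ).mulVec (F ξ)) :=
    (ixW_meas u u hu hu).neg.add (leray_meas F hF)
  exact ((WithLp.measurable_toLp 2 _).comp h).aestronglyMeasurable

lemma ae_ne0 : ∀ᵐ ξ : E3, ξ ≠ 0 := by
  simp [ae_iff]

lemma GG_bd (η : ℝ) (hB : StationaryBilinearEstimate η) (ε : ℝ) (F u : E3 → V3)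
    (hu : Measurable u) (hF : ∀ᵐ ξ : E3, ‖F ξ‖ ≤ ε) (A : ℝ) (hA : 0 ≤ A) (huA : Bd A u) :
    ∀ᵐ ξ : E3, ‖GG F u ξ‖ ≤ KK * A * A + Real.sqrt 3 * ε := by
  filter_upwards [main_est η hB u u hu hu A A hA huA huA, hF, ae_ne0] with ξ h1 h2 h3
  calc ‖GG F u ξ‖ = ‖-toH ((LerayP ξ).mulVec (ixW u u ξ)) + toH ((LerayP ξ).mulVec (F ξ))‖ := rfl
    _ ≤ ‖toH ((LerayP ξ).mulVec (ixW u u ξ))‖ + ‖toH ((LerayP ξ).mulVec (F ξ))‖ := by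
      refine (norm_add_le _ _).trans ?_
      rw [norm_neg]
    _ ≤ _ := by
      have h4 := (leray_norm ξ h3 (F ξ)).trans (toH_le _)
      have h5 : Real.sqrt 3 * ‖F ξ‖ ≤ Real.sqrt 3 * ε := by gcongr
      linarith

lemma GG_diff (η : ℝ) (hB : StationaryBilinearEstimate η) (F u v : E3 → V3)
    (hu : Measurable u) (hv : Measurable v) (A D : ℝ) (hA : 0 ≤ A) (hD : 0 ≤ D)
    (huA : Bd A u) (hvA : Bd A v) (hd : Bd D (u - v)) :
    ∀ᵐ ξ : E3, ‖GG F u ξ - GG F v ξ‖ ≤ 2 * KK * A * D := by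
  filter_upwards [main_est η hB (u - v) u (hu.sub hv) hu D A hD hd huA,
    main_est η hB v (u - v) hv (hu.sub hv) A D hA hvA hd,
    diff_eq η hB u v hu hv huA.pm hvA.pm] with ξ h1 h2 h3
  have : GG F u ξ - GG F v ξ = -toH ((LerayP ξ).mulVec (ixW u u ξ) -
      (LerayP ξ).mulVec (ixW v v ξ)) := by
    ext j
    simp [GG]
    ring
  rw [this, norm_neg, h3]
  refine (norm_add_le (toH ((LerayP ξ).mulVec (ixW (u - v) u ξ)))
    (toH ((LerayP ξ).mulVec (ixW v (u - v) ξ)))).trans ?_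
  linarith

lemma exists_fix (η ε : ℝ) (hη : 0 < η) (hB : StationaryBilinearEstimate η)
    (hε : 0 < ε) (hε' : ε < 1 / (4 * η))
    (F : E3 → V3) (hFm : Measurable F) (hF : ∀ᵐ ξ : E3, ‖F ξ‖ ≤ ε) :
    ∃ f : XL, ‖f‖ ≤ 4 / Real.sqrt 3 * ε ∧ ∀ᵐ ξ : E3, f ξ = GG F (uf f) ξ := by
  have hmem : ∀ f : XL, MemLp (GG F (uf f)) ⊤ (volume : Measure E3) := fun f =>
    memLp_top_of_bound (GG_meas F _ hFm (uf_meas f)) _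
      (GG_bd η hB ε F (uf f) (uf_meas f) hF ‖f‖ (norm_nonneg _) (uf_bd f))
  set T : XL → XL := fun f => (hmem f).toLp _ with hT
  have hTae : ∀ f, ∀ᵐ ξ : E3, T f ξ = GG F (uf f) ξ := fun f => (hmem f).coeFn_toLp
  set r := 4 / Real.sqrt 3 * ε with hr
  have h3 : 0 < Real.sqrt 3 := by positivity
  have h3s : Real.sqrt 3 ^ 2 = 3 := Real.sq_sqrt (by norm_num)
  have hr0 : 0 ≤ r := by positivity
  have hK := eta_bound η hη hB
  have hηε : 4 * η * ε < 1 := by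
    rw [lt_div_iff₀ (by positivity)] at hε'; linarith
  have hKε : 16 * (KK * ε) ≤ Real.sqrt 3 := by
    have : 4 * KK * ε ≤ Real.sqrt 3 * η * ε := by gcongr
    nlinarith
  have hr3 : r * Real.sqrt 3 = 4 * ε := by rw [hr]; field_simp
  have hKr : 4 * (KK * r) ≤ 1 := by
    have : 4 * (KK * r) * Real.sqrt 3 ≤ 1 * Real.sqrt 3 := by
      calc 4 * (KK * r) * Real.sqrt 3 = 16 * (KK * ε) := by
            rw [show 4 * (KK * r) * Real.sqrt 3 = 4 * KK * (r * Real.sqrt 3) by ring, hr3]; ring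
        _ ≤ _ := by linarith
    exact le_of_mul_le_mul_right this h3
  have hs3 : Real.sqrt 3 * ε = 3 / 4 * r := by
    have : Real.sqrt 3 * (4 * ε) = 3 * r := by
      rw [← hr3]; linear_combination r * h3s
    linarith
  have hmaps : Set.MapsTo T (Metric.closedBall 0 r) (Metric.closedBall 0 r) := by
    intro f hf
    rw [mem_closedBall_zero_iff] at hf ⊢
    refine XL_norm_le _ _ hr0 ?_
    have hb : Bd r (uf f) := by
      filter_upwards [uf_bd f] with z hz
      exact hz.trans (by gcongr)
    filter_upwards [hTae f, GG_bd η hB ε F (uf f) (uf_meas f) hF r hr0 hb] with ξ h1 h2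
    rw [h1]
    refine h2.trans ?_
    nlinarith
  have hcontr : ContractingWith (1 / 2) (hmaps.restrict T _ _) := by
    refine ⟨by rw [← NNReal.coe_lt_coe]; norm_num, LipschitzWith.of_dist_le_mul ?_⟩
    rintro ⟨f, hf⟩ ⟨g, hg⟩
    rw [Subtype.dist_eq, Subtype.dist_eq, dist_eq_norm, dist_eq_norm]
    change ‖T f - T g‖ ≤ _ * ‖f - g‖
    rw [mem_closedBall_zero_iff] at hf hg
    refine XL_norm_le _ _ (by positivity) ?_
    have hb : Bd r (uf f) := by
      filter_upwards [uf_bd f] with z hz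
      exact hz.trans (by gcongr)
    have hb2 : Bd r (uf g) := by
      filter_upwards [uf_bd g] with z hz
      exact hz.trans (by gcongr)
    filter_upwards [hTae f, hTae g, Lp.coeFn_sub (T f) (T g),
      GG_diff η hB F (uf f) (uf g) (uf_meas f) (uf_meas g) r ‖f - g‖ hr0 (norm_nonneg _) hb hb2
        (uf_sub_bd f g)] with ξ h1 h2 h3 h4
    rw [h3, Pi.sub_apply, h1, h2]
    refine h4.trans ?_
    push_cast
    have := norm_nonneg (f - g)
    nlinarith
  obtain ⟨f, hf, hfix, -⟩ := hcontr.exists_fixedPoint' Metric.isClosed_closedBall.isComplete hmaps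
    (x := 0) (by simpa using hr0) (edist_ne_top _ _)
  refine ⟨f, by simpa using hf, ?_⟩
  filter_upwards [hTae f] with ξ h1
  rw [← h1, hfix.eq]

lemma pm_ae {a : ℝ} {u : E3 → V3} {C : ℝ} (hC : 0 ≤ C) (h : PMnorm a u ≤ ENNReal.ofReal C) :
    ∀ᵐ ξ : E3, ‖ξ‖ ^ a * ‖u ξ‖ ≤ C := by
  filter_upwards [ENNReal.ae_le_essSup (μ := volume)
    (fun ξ : E3 => ENNReal.ofReal (‖ξ‖ ^ a * ‖u ξ‖))] with ξ hξ
  exact (ENNReal.ofReal_le_ofReal_iff hC).1 (hξ.trans h)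

lemma uniq (η ε : ℝ) (hη : 0 < η) (hB : StationaryBilinearEstimate η)
    (hε : 0 < ε) (hε' : ε < 1 / (4 * η)) (F u v : E3 → V3) (hu : Measurable u) (hv : Measurable v)
    (hub : PMnorm 2 u ≤ ENNReal.ofReal (2 * ε)) (hvb : PMnorm 2 v ≤ ENNReal.ofReal (2 * ε))
    (hus : IsStationarySolution F u) (hvs : IsStationarySolution F v) :
    ∀ᵐ ξ : E3, v ξ = u ξ := by
  have hηε : 4 * η * ε < 1 := by
    rw [lt_div_iff₀ (by positivity)] at hε'; linarith
  have hut : PMnorm 2 u ≠ ⊤ := ne_top_of_le_ne_top ENNReal.ofReal_ne_top hub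
  have hvt : PMnorm 2 v ≠ ⊤ := ne_top_of_le_ne_top ENNReal.ofReal_ne_top hvb
  have hε2 : 0 ≤ 2 * ε := by positivity
  have hdt : PMnorm 2 (v - u) ≤ ENNReal.ofReal (4 * ε) := by
    refine essSup_le_of_ae_le _ ?_
    filter_upwards [pm_ae hε2 hub, pm_ae hε2 hvb] with ξ h1 h2
    apply ENNReal.ofReal_le_ofReal
    have := norm_sub_le (v ξ) (u ξ)
    have h0 : 0 ≤ ‖ξ‖ ^ (2:ℝ) := by positivity
    rw [Pi.sub_apply]
    have h4 := mul_le_mul_of_nonneg_left this h0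
    linarith
  have hdt' : PMnorm 2 (v - u) ≠ ⊤ := ne_top_of_le_ne_top ENNReal.ofReal_ne_top hdt
  set D := (PMnorm 2 (v - u)).toReal with hD
  have hD0 : 0 ≤ D := ENNReal.toReal_nonneg
  have hDe : PMnorm 2 (v - u) = ENNReal.ofReal D := (ENNReal.ofReal_toReal hdt').symm
  have e1 : PMnorm 0 (fun ξ => (LerayP ξ).mulVec (ixW (v - u) v ξ)) ≤
      ENNReal.ofReal (η * D * (2 * ε)) := by
    refine (hB (v - u) v (hv.sub hu) hv hdt' hvt).2.trans ?_
    rw [ENNReal.ofReal_mul (by positivity), ENNReal.ofReal_mul hη.le, hDe]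
    gcongr
  have e2 : PMnorm 0 (fun ξ => (LerayP ξ).mulVec (ixW u (v - u) ξ)) ≤
      ENNReal.ofReal (η * (2 * ε) * D) := by
    refine (hB u (v - u) hu (hv.sub hu) hut hdt').2.trans ?_
    rw [ENNReal.ofReal_mul (by positivity), ENNReal.ofReal_mul hη.le, hDe]
    gcongr
  have hle : PMnorm 2 (v - u) ≤ ENNReal.ofReal (4 * η * ε * D) := by
    refine essSup_le_of_ae_le _ ?_
    filter_upwards [pm_ae (by positivity) e1, pm_ae (by positivity) e2, hus, hvs, ae_ne0,
      diff_eq η hB v u hv hu hvt hut] with ξ h1 h2 h3 h4 h5 h6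
    apply ENNReal.ofReal_le_ofReal
    have hn : 0 < ‖ξ‖ := norm_pos_iff.2 h5
    rw [Real.rpow_zero, one_mul] at h1 h2
    have h7 : (v - u) ξ = -((‖ξ‖ ^ 2)⁻¹ • ((LerayP ξ).mulVec (ixW (v - u) v ξ) +
        (LerayP ξ).mulVec (ixW u (v - u) ξ))) := by
      rw [← h6, Pi.sub_apply, h3 h5, h4 h5, ← smul_sub, ← smul_neg]
      congr 1
      abel
    rw [h7, norm_neg, norm_smul, Real.norm_of_nonneg (by positivity), Real.rpow_two, ← mul_assoc,
      mul_inv_cancel₀ (by positivity), one_mul]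
    refine (norm_add_le _ _).trans ?_
    linarith
  rw [hDe, ENNReal.ofReal_le_ofReal_iff (by positivity)] at hle
  have hD00 : D = 0 := by nlinarith
  have hz : PMnorm 2 (v - u) ≤ ENNReal.ofReal 0 := by rw [hDe, hD00]
  filter_upwards [pm_ae le_rfl hz, ae_ne0] with ξ h1 h5
  have hn : 0 < ‖ξ‖ ^ (2:ℝ) := by
    have := norm_pos_iff.2 h5
    positivity
  have : ‖(v - u) ξ‖ ≤ 0 := by
    by_contra hc
    push Not at hc
    nlinarith [mul_pos hn hc]
  exact sub_eq_zero.1 (norm_le_zero_iff.1 this)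

/-- **Existence and uniqueness of small stationary solutions:** if `η` satisfies
the stationary bilinear estimate and `‖F̂‖_{PM} < ε < 1/(4η)`, then there is a
stationary solution `û_∞` with `‖û_∞‖_{PM²} ≤ 2ε`, unique with this bound. -/
theorem stationary_existence (η ε : ℝ) (hη : 0 < η)
    (hB : StationaryBilinearEstimate η)
    (hε : 0 < ε) (hε' : ε < 1 / (4 * η))
    (F : E3 → V3) (hFm : Measurable F) (hF : PMnorm 0 F < ENNReal.ofReal ε) :
    ∃ u : E3 → V3, Measurable u ∧ PMnorm 2 u ≤ ENNReal.ofReal (2 * ε) ∧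
      (∀ᵐ ξ : E3, ∀ j k : Fin 3, Integrable (fun z : E3 => u (ξ - z) j * u z k)) ∧
      IsStationarySolution F u ∧
      (∀ v : E3 → V3, Measurable v → PMnorm 2 v ≤ ENNReal.ofReal (2 * ε) →
        IsStationarySolution F v → ∀ᵐ ξ : E3, v ξ = u ξ) := by
  have hF1 : ∀ᵐ ξ : E3, ‖F ξ‖ ≤ ε := by
    filter_upwards [pm_ae hε.le hF.le] with ξ h
    rwa [Real.rpow_zero, one_mul] at h
  obtain ⟨f, hfn, hf⟩ := exists_fix η ε hη hB hε hε' F hFm hF1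
  have hum := uf_meas f
  have hub : Bd (4 / Real.sqrt 3 * ε) (uf f) := by
    filter_upwards [uf_bd f] with z hz
    exact hz.trans (by gcongr)
  have hpm : PMnorm 2 (uf f) ≤ ENNReal.ofReal (2 * ε) := by
    have h3 : 0 < Real.sqrt 3 := by positivity
    have h3s : Real.sqrt 3 ^ 2 = 3 := Real.sq_sqrt (by norm_num)
    have hK := eta_bound η hη hB
    have hηε : 4 * η * ε < 1 := by
      rw [lt_div_iff₀ (by positivity)] at hε'; linarith
    have hKε : 16 * (KK * ε) ≤ Real.sqrt 3 := by
      have : 4 * KK * ε ≤ Real.sqrt 3 * η * ε := by gcongr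
      nlinarith
    have hs : Real.sqrt 3 ≤ 9 / 5 := by
      rw [Real.sqrt_le_left (by norm_num)]; norm_num
    have hq : KK * (4 / Real.sqrt 3 * ε) * (4 / Real.sqrt 3 * ε) ≤ 3 / 5 * ε := by
      have : KK * (4 / Real.sqrt 3 * ε) * (4 / Real.sqrt 3 * ε) = 16 * (KK * ε) / 3 * ε := by
        field_simp; rw [h3s]; ring
      rw [this]
      exact mul_le_mul_of_nonneg_right (by linarith) hε.le
    refine essSup_le_of_ae_le _ ?_
    filter_upwards [hf, ae_ne0, hF1,
      main_est η hB (uf f) (uf f) hum hum _ _ (by positivity) hub hub] with ξ h1 h2 h4 h5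
    apply ENNReal.ofReal_le_ofReal
    have hn : 0 < ‖ξ‖ := norm_pos_iff.2 h2
    have h6 : ‖ξ‖ ^ (2:ℝ) * ‖uf f ξ‖ = ‖(f ξ).ofLp‖ := by
      rw [uf, norm_smul, Real.norm_of_nonneg (by positivity), Real.rpow_two, ← mul_assoc,
        mul_inv_cancel₀ (by positivity), one_mul]
    rw [h6, h1]
    change ‖-(LerayP ξ).mulVec (ixW (uf f) (uf f) ξ) + (LerayP ξ).mulVec (F ξ)‖ ≤ _
    refine (norm_add_le _ _).trans ?_
    rw [norm_neg]
    have h7 := (norm_le_toH _).trans h5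
    have h8 := leray_sup ξ h2 (F ξ)
    linarith
  have hsol : IsStationarySolution F (uf f) := by
    filter_upwards [hf] with ξ h1 h2
    conv_lhs => rw [uf, h1]
    rfl
  refine ⟨uf f, hum, hpm, (hB _ _ hum hum hub.pm hub.pm).1, hsol, fun v hv hvb hvs => ?_⟩
  exact uniq η ε hη hB hε hε' F (uf f) v hum hv hpm hvb hsol hvs
end
end

section
/- For every p ∈ (3, ∞] there exists a constant C = C(p) such that for every measurable g : ℝ³ → ℂ with M := ess sup_{ξ∈ℝ³} |ξ|² |g(ξ)| < ∞ and every t > 0, the function (S_t g)(x) := (2π)^{−3/2} ∫_{ℝ³} e^{i x·ξ} e^{−t|ξ|²} g(ξ) dξ is well defined (the integral converges absolutely since e^{−t|ξ|²}|g(ξ)| ≤ M e^{−t|ξ|²}|ξ|^{−2} ∈ L¹(ℝ³)) and satisfies ‖S_t g‖_{L^p(ℝ³)} ≤ C t^{−(1−3/p)/2} M. -/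
open MeasureTheory Filter
open scoped ENNReal

noncomputable section

/-- The scalar `PM^a` norm (on the Fourier side): `ess sup_ξ |ξ|^a |g(ξ)|`. -/
def PMnormC (a : ℝ) (g : E3 → ℂ) : ℝ≥0∞ :=
  essSup (fun ξ : E3 => ENNReal.ofReal (‖ξ‖ ^ a * ‖g ξ‖)) volume

/-- The heat semigroup applied to the (inverse Fourier transform of) `g`,
written as the inverse Fourier integral
`(S_t g)(x) = (2π)^{-3/2} ∫ e^{i x·ξ} e^{-t|ξ|²} g(ξ) dξ`. -/
def heatFlow (g : E3 → ℂ) (t : ℝ) (x : E3) : ℂ :=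
  (((2 * Real.pi) ^ ((3 : ℝ) / 2))⁻¹ : ℝ) •
    ∫ ξ : E3, Complex.exp (Complex.I * ((∑ j, x j * ξ j : ℝ) : ℂ)) *
      (Real.exp (-t * ‖ξ‖ ^ 2) : ℂ) * g ξ

open FourierTransform SchwartzMap in
theorem plancherel_le (f : E3 → ℂ) (hf : Integrable f) :
    eLpNorm (𝓕 f) 2 volume ≤ eLpNorm f 2 volume := by
  by_cases h2 : MemLp f 2 volume
  swap
  · have : eLpNorm f 2 volume = ⊤ := by
      by_contra h
      exact h2 ⟨hf.1, lt_top_iff_ne_top.2 h⟩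
    simp [this]
  have hcont : Continuous (𝓕 f) :=
    VectorFourier.fourierIntegral_continuous Real.continuous_fourierChar
      (by exact continuous_inner) hf
  set h : Lp (α := E3) ℂ 2 volume := 𝓕 (h2.toLp f) with hh
  have key : (h : E3 → ℂ) =ᵐ[volume] 𝓕 f := by
    apply ae_eq_of_integral_contDiff_smul_eq
    · exact (Lp.memLp h).locallyIntegrable (μ := volume) (p := 2) one_le_two
    · exact hcont.locallyIntegrable
    · intro g g_smooth g_cpt
      have hg₁ : HasCompactSupport (Complex.ofRealCLM ∘ g) := g_cpt.comp_left rfl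
      have hg₂ : ContDiff ℝ (⊤ : ℕ∞) (Complex.ofRealCLM ∘ g) := by fun_prop
      set φ : 𝓢(E3, ℂ) := hg₁.toSchwartzMap hg₂ with hφ
      have e1 : ∫ x, g x • h x = Lp.toTemperedDistribution h φ := by simp [hφ]
      have e2 : ∫ x, g x • 𝓕 f x = ∫ x, φ x • 𝓕 f x := by simp [hφ]
      rw [e1, e2, hh, ← Lp.fourier_toTemperedDistribution_eq, TemperedDistribution.fourier_apply,
        Lp.toTemperedDistribution_apply]
      have e3 : ∫ x, (𝓕 φ) x • (h2.toLp f) x = ∫ x, (𝓕 φ) x • f x := by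
        apply integral_congr_ae
        filter_upwards [h2.coeFn_toLp] with x hx
        rw [hx]
      rw [e3, SchwartzMap.fourier_coe]
      have := VectorFourier.integral_fourierIntegral_smul_eq_flip (L := innerₗ E3)
        (μ := volume) (ν := volume) (f := (φ : E3 → ℂ)) (g := f) Real.continuous_fourierChar
        (by exact continuous_inner) φ.integrable hf
      rw [flip_innerₗ] at this
      exact this
  rw [← eLpNorm_congr_ae key, ← eLpNorm_congr_ae h2.coeFn_toLp, ← Lp.enorm_def, ← Lp.enorm_def]
  rw [← ofReal_norm, ← ofReal_norm, hh, Lp.norm_fourier_eq]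

/-- total mass of the unit sphere -/
def sph : ℝ := 3 * (volume : Measure E3).real (Metric.ball 0 1)

theorem sph_pos : 0 < sph := by
  unfold sph
  have : 0 < (volume : Measure E3).real (Metric.ball 0 1) :=
    ENNReal.toReal_pos (Metric.measure_ball_pos _ _ one_pos).ne' measure_ball_lt_top.ne
  positivity

theorem gauss_integrable {s t : ℝ} (hs : -3 < s) (ht : 0 < t) :
    Integrable (fun ξ : E3 => ‖ξ‖ ^ s * Real.exp (-t * ‖ξ‖ ^ 2)) := by
  rw [integrable_fun_norm_addHaar volume (f := fun r : ℝ => r ^ s * Real.exp (-t * r ^ 2))]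
  have := integrableOn_rpow_mul_exp_neg_mul_rpow (p := 2) (s := s + 2) (b := t) (by linarith)
    (by norm_num) ht
  refine this.congr_fun (fun x hx => ?_) measurableSet_Ioi
  have hx : 0 < x := hx
  simp [Real.rpow_add hx]
  ring

theorem gauss_integral {s t : ℝ} (hs : -3 < s) (ht : 0 < t) :
    ∫ ξ : E3, ‖ξ‖ ^ s * Real.exp (-t * ‖ξ‖ ^ 2) =
      sph * (1 / 2 * Real.Gamma ((s + 3) / 2)) * t ^ (-(s + 3) / 2) := by
  rw [integral_fun_norm_addHaar volume (fun r : ℝ => r ^ s * Real.exp (-t * r ^ 2))]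
  have := integral_rpow_mul_exp_neg_mul_rpow (p := 2) (q := s + 2) (b := t) (by norm_num)
    (by linarith) ht
  have e : ∫ x in Set.Ioi (0:ℝ), x ^ (Module.finrank ℝ E3 - 1) • (x ^ s * Real.exp (-t * x ^ 2))
      = ∫ x in Set.Ioi (0:ℝ), x ^ (s + 2) * Real.exp (-t * x ^ (2:ℝ)) := by
    refine setIntegral_congr_fun measurableSet_Ioi (fun x hx => ?_)
    have hx : 0 < x := hx
    simp [Real.rpow_add hx]
    ring
  rw [e, this]
  simp only [finrank_euclideanSpace, Fintype.card_fin, nsmul_eq_mul, smul_eq_mul, sph]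
  rw [show s + 2 + 1 = s + 3 by ring]
  push_cast
  ring

theorem gauss_lintegral {s t : ℝ} (hs : -3 < s) (ht : 0 < t) :
    ∫⁻ ξ : E3, ENNReal.ofReal (‖ξ‖ ^ s * Real.exp (-t * ‖ξ‖ ^ 2)) =
      ENNReal.ofReal (sph * (1 / 2 * Real.Gamma ((s + 3) / 2)) * t ^ (-(s + 3) / 2)) := by
  rw [← gauss_integral hs ht, ofReal_integral_eq_lintegral_ofReal (gauss_integrable hs ht)]
  exact Eventually.of_forall fun ξ => by positivity

theorem low_integral {R : ℝ} (hR : 0 < R) :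
    ∫⁻ ξ in Metric.ball (0 : E3) R, ENNReal.ofReal (‖ξ‖ ^ (-2 : ℝ)) =
      ENNReal.ofReal (sph * R) := by
  have aux : ∀ x ∈ Set.Ioi (0:ℝ), x ^ (Module.finrank ℝ E3 - 1) •
      (Set.Iio R).indicator (fun r : ℝ => r ^ (-2 : ℝ)) x = (Set.Iio R).indicator 1 x := by
    intro x hx
    have hx : 0 < x := hx
    by_cases h : x < R
    · simp [h]
      field_simp
    · simp [h]
  have hI : ∫ x in Set.Ioi (0:ℝ), (Set.Iio R).indicator (1 : ℝ → ℝ) x = R := by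
    rw [integral_indicator measurableSet_Iio, Measure.restrict_restrict measurableSet_Iio,
      Set.inter_comm, Set.Ioi_inter_Iio]
    simp [hR.le]
  have hi : IntegrableOn ((Set.Iio R).indicator (1 : ℝ → ℝ)) (Set.Ioi 0) := by
    by_contra h
    rw [integral_undef h] at hI
    exact hR.ne hI
  have h1 : Integrable (fun ξ : E3 => (Set.Iio R).indicator (fun r : ℝ => r ^ (-2 : ℝ)) ‖ξ‖) := by
    rw [integrable_fun_norm_addHaar volume (f := (Set.Iio R).indicator (fun r : ℝ => r ^ (-2 : ℝ)))]
    exact hi.congr_fun (fun x hx => (aux x hx).symm) measurableSet_Ioi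
  have h2 : ∫ ξ : E3, (Set.Iio R).indicator (fun r : ℝ => r ^ (-2 : ℝ)) ‖ξ‖ = sph * R := by
    rw [integral_fun_norm_addHaar volume, setIntegral_congr_fun measurableSet_Ioi aux, hI]
    simp only [finrank_euclideanSpace, Fintype.card_fin, nsmul_eq_mul, smul_eq_mul, sph]
    push_cast
    ring
  rw [← h2, ofReal_integral_eq_lintegral_ofReal h1, ← lintegral_indicator measurableSet_ball]
  · apply lintegral_congr
    intro ξ
    by_cases h : ‖ξ‖ < R <;> simp [h]
  · refine Eventually.of_forall fun ξ => Set.indicator_apply_nonneg fun _ => by positivity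

open FourierTransform in
theorem plancherel_sq (f : E3 → ℂ) (hf : Integrable f) :
    ∫⁻ x, ‖𝓕 f x‖ₑ ^ 2 ≤ ∫⁻ x, ‖f x‖ₑ ^ 2 := by
  have h := plancherel_le f hf
  have e : ∀ u : E3 → ℂ, eLpNorm u 2 volume ^ 2 = ∫⁻ x, ‖u x‖ₑ ^ 2 := by
    intro u
    have := eLpNorm_nnreal_pow_eq_lintegral (f := u) (μ := volume) (p := 2) (by norm_num)
    simpa using this
  rw [← e, ← e]
  gcongr

open FourierTransform in
theorem fourier_enorm_le (f : E3 → ℂ) (x : E3) : ‖𝓕 f x‖ₑ ≤ ∫⁻ ξ, ‖f ξ‖ₑ := by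
  rw [Real.fourier_eq]
  refine (enorm_integral_le_lintegral_enorm _).trans (le_of_eq ?_)
  apply lintegral_congr
  intro ξ
  rw [← ofReal_norm, ← ofReal_norm, Circle.norm_smul]

open FourierTransform in
theorem weak_bound (f : E3 → ℂ) (hf : Integrable f) {t : ℝ} (ht : 0 < t)
    (hb : ∀ᵐ ξ : E3, ‖f ξ‖ ≤ ‖ξ‖ ^ (-2 : ℝ) * Real.exp (-t * ‖ξ‖ ^ 2)) {l : ℝ} (hl : 0 < l) :
    volume {x : E3 | l < ‖𝓕 f x‖} ≤ ENNReal.ofReal (4 * l ^ (-2 : ℝ)) *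
      ∫⁻ ξ : E3, {ξ : E3 | l ≤ 2 * sph * ‖ξ‖}.indicator
        (fun ξ => ENNReal.ofReal (‖ξ‖ ^ (-4 : ℝ) * Real.exp (-(2 * t) * ‖ξ‖ ^ 2))) ξ := by
  have hsph := sph_pos
  set R : ℝ := l / (2 * sph) with hR
  have hRpos : 0 < R := by positivity
  set S : Set E3 := Metric.ball 0 R with hS
  have hSm : MeasurableSet S := measurableSet_ball
  have hSc : Sᶜ = {ξ : E3 | l ≤ 2 * sph * ‖ξ‖} := by
    ext ξ
    simp only [hS, Set.mem_compl_iff, mem_ball_zero_iff, not_lt, Set.mem_ofPred_eq, hR]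
    rw [div_le_iff₀ (by positivity), mul_comm]
  have hlo : Integrable (S.indicator f) := hf.indicator hSm
  have hhi : Integrable (Sᶜ.indicator f) := hf.indicator hSm.compl
  have hsum : ∀ x, 𝓕 f x = 𝓕 (S.indicator f) x + 𝓕 (Sᶜ.indicator f) x := by
    intro x
    have : f = S.indicator f + Sᶜ.indicator f := (Set.indicator_self_add_compl S f).symm
    conv_lhs => rw [this]
    simp only [Real.fourier_eq]
    rw [← integral_add]
    · simp only [Pi.add_apply, smul_add]
    · exact (Real.fourierIntegral_convergent_iff x).2 hlo
    · exact (Real.fourierIntegral_convergent_iff x).2 hhi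
  have hlow : ∀ x, ‖𝓕 (S.indicator f) x‖ ≤ l / 2 := by
    intro x
    have h1 := fourier_enorm_le (S.indicator f) x
    have h2 : ∫⁻ ξ, ‖S.indicator f ξ‖ₑ ≤ ENNReal.ofReal (sph * R) := by
      rw [← low_integral hRpos]
      simp_rw [enorm_indicator_eq_indicator_enorm]
      rw [lintegral_indicator hSm]
      apply lintegral_mono_ae
      filter_upwards [ae_restrict_of_ae hb] with ξ hξ
      rw [← ofReal_norm]
      apply ENNReal.ofReal_le_ofReal
      refine hξ.trans (mul_le_of_le_one_right (by positivity) ?_)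
      rw [Real.exp_le_one_iff]
      nlinarith [sq_nonneg ‖ξ‖]
    have h3 := h1.trans h2
    rw [← ofReal_norm, ENNReal.ofReal_le_ofReal_iff (by positivity)] at h3
    refine h3.trans (le_of_eq ?_)
    rw [hR]; field_simp
  have hsub : {x : E3 | l < ‖𝓕 f x‖} ⊆
      {x : E3 | ENNReal.ofReal ((l / 2) ^ 2) ≤ ‖𝓕 (Sᶜ.indicator f) x‖ₑ ^ 2} := by
    intro x hx
    simp only [Set.mem_ofPred_eq] at hx ⊢
    rw [hsum x] at hx
    have := norm_add_le (𝓕 (S.indicator f) x) (𝓕 (Sᶜ.indicator f) x)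
    have h4 := hlow x
    rw [ENNReal.ofReal_pow (by positivity), ← ofReal_norm]
    gcongr
    linarith
  have hcont : Continuous (𝓕 (Sᶜ.indicator f)) :=
    VectorFourier.fourierIntegral_continuous Real.continuous_fourierChar
      (by exact continuous_inner) hhi
  have hch := mul_meas_ge_le_lintegral (μ := (volume : Measure E3))
    (f := fun x => ‖𝓕 (Sᶜ.indicator f) x‖ₑ ^ 2) (by have := hcont.measurable; fun_prop)
    (ENNReal.ofReal ((l / 2) ^ 2))
  have hfin : ∫⁻ x, ‖Sᶜ.indicator f x‖ₑ ^ 2 ≤ ∫⁻ ξ : E3, {ξ : E3 | l ≤ 2 * sph * ‖ξ‖}.indicator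
        (fun ξ => ENNReal.ofReal (‖ξ‖ ^ (-4 : ℝ) * Real.exp (-(2 * t) * ‖ξ‖ ^ 2))) ξ := by
    rw [← hSc]
    apply lintegral_mono_ae
    filter_upwards [hb] with ξ hξ
    by_cases h : ξ ∈ Sᶜ
    · rw [Set.indicator_of_mem h, Set.indicator_of_mem h, ← ofReal_norm,
        ← ENNReal.ofReal_pow (norm_nonneg _)]
      apply ENNReal.ofReal_le_ofReal
      calc ‖f ξ‖ ^ 2 ≤ (‖ξ‖ ^ (-2 : ℝ) * Real.exp (-t * ‖ξ‖ ^ 2)) ^ 2 := by gcongr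
        _ = _ := by
          rw [mul_pow, ← Real.exp_nat_mul, ← Real.rpow_mul_natCast (norm_nonneg _)]
          norm_num
          left; ring
    · rw [Set.indicator_of_notMem h, Set.indicator_of_notMem h]
      simp
  have hall := (hch.trans (plancherel_sq _ hhi)).trans hfin
  refine (measure_mono hsub).trans ?_
  set m := volume {x : E3 | ENNReal.ofReal ((l / 2) ^ 2) ≤ ‖𝓕 (Sᶜ.indicator f) x‖ₑ ^ 2}
  calc m = ENNReal.ofReal (4 * l ^ (-2 : ℝ)) * (ENNReal.ofReal ((l / 2) ^ 2) * m) := by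
        rw [← mul_assoc, ← ENNReal.ofReal_mul (by positivity)]
        rw [Real.rpow_neg hl.le]
        norm_cast
        rw [show 4 * (l ^ 2)⁻¹ * (l / 2) ^ 2 = 1 by field_simp; norm_num]
        simp
    _ ≤ _ := by gcongr

theorem inner_int {p a : ℝ} (hp : 3 < p) (ha : 0 ≤ a) :
    ∫⁻ l in Set.Ioi (0:ℝ), {l : ℝ | l ≤ a}.indicator (fun l => ENNReal.ofReal (l ^ (p - 3))) l
      = ENNReal.ofReal (a ^ (p - 2) / (p - 2)) := by
  have hm : MeasurableSet {l : ℝ | l ≤ a} := measurableSet_Iic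
  rw [lintegral_indicator hm, Measure.restrict_restrict hm, Set.inter_comm]
  change ∫⁻ l in Set.Ioc 0 a, _ = _
  have hi : IntervalIntegrable (fun l : ℝ => l ^ (p - 3)) volume 0 a :=
    intervalIntegral.intervalIntegrable_rpow' (by linarith)
  have hv : ∫ l in (0:ℝ)..a, l ^ (p - 3) = a ^ (p - 2) / (p - 2) := by
    rw [integral_rpow (Or.inl (by linarith))]
    rw [show p - 3 + 1 = p - 2 by ring, Real.zero_rpow (by linarith), sub_zero]
  rw [← hv, intervalIntegral.integral_of_le ha, ofReal_integral_eq_lintegral_ofReal]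
  · exact (intervalIntegrable_iff_integrableOn_Ioc_of_le ha).1 hi
  · filter_upwards [ae_restrict_mem measurableSet_Ioc] with l hl
    exact Real.rpow_nonneg hl.1.le _

open FourierTransform in
theorem strong_bound (f : E3 → ℂ) (hf : Integrable f) {t p : ℝ} (ht : 0 < t) (hp : 3 < p)
    (hb : ∀ᵐ ξ : E3, ‖f ξ‖ ≤ ‖ξ‖ ^ (-2 : ℝ) * Real.exp (-t * ‖ξ‖ ^ 2)) :
    ∫⁻ x, ENNReal.ofReal (‖𝓕 f x‖ ^ p) ≤ ENNReal.ofReal (p * (4 * ((2 * sph) ^ (p - 2) / (p - 2)))) *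
      ∫⁻ ξ : E3, ENNReal.ofReal (‖ξ‖ ^ (p - 6) * Real.exp (-(2 * t) * ‖ξ‖ ^ 2)) := by
  have hsph := sph_pos
  have hp2 : 0 < p - 2 := by linarith
  have hcont : Continuous (𝓕 f) :=
    VectorFourier.fourierIntegral_continuous Real.continuous_fourierChar
      (by exact continuous_inner) hf
  rw [lintegral_rpow_eq_lintegral_meas_lt_mul volume
    (Eventually.of_forall fun x => norm_nonneg _) hcont.norm.measurable.aemeasurable
    (by linarith : 0 < p)]
  rw [ENNReal.ofReal_mul (by linarith), mul_assoc]
  gcongr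
  set G : E3 → ℝ≥0∞ := fun ξ => ENNReal.ofReal (‖ξ‖ ^ (-4 : ℝ) * Real.exp (-(2 * t) * ‖ξ‖ ^ 2))
    with hG
  have hGm : Measurable G := by rw [hG]; fun_prop
  set T : Set (ℝ × E3) := {z | z.1 ≤ 2 * sph * ‖z.2‖} with hT
  have hTm : MeasurableSet T := by
    apply measurableSet_le <;> fun_prop
  set H : ℝ × E3 → ℝ≥0∞ := T.indicator (fun z => ENNReal.ofReal (z.1 ^ (p - 3)) * G z.2) with hH
  have hHm : Measurable H := by
    rw [hH]
    apply Measurable.indicator _ hTm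
    fun_prop
  calc ∫⁻ l in Set.Ioi (0:ℝ), volume {a | l < ‖𝓕 f a‖} * ENNReal.ofReal (l ^ (p - 1))
      ≤ ∫⁻ l in Set.Ioi (0:ℝ), 4 * ∫⁻ ξ, H (l, ξ) := by
        apply setLIntegral_mono' measurableSet_Ioi
        intro l hl
        have hl : 0 < l := hl
        have hw := weak_bound f hf ht hb hl
        have e : ∫⁻ ξ, H (l, ξ) = ENNReal.ofReal (l ^ (p - 3)) *
            ∫⁻ ξ : E3, {ξ : E3 | l ≤ 2 * sph * ‖ξ‖}.indicator G ξ := by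
          rw [← lintegral_const_mul' _ _ ENNReal.ofReal_ne_top]
          apply lintegral_congr
          intro ξ
          by_cases h : l ≤ 2 * sph * ‖ξ‖ <;> simp [hH, hT, h]
        rw [e]
        calc _ ≤ _ := mul_le_mul_left hw _
          _ = (ENNReal.ofReal (4 * l ^ (-2 : ℝ)) * ENNReal.ofReal (l ^ (p - 1))) * 
            ∫⁻ ξ : E3, {ξ : E3 | l ≤ 2 * sph * ‖ξ‖}.indicator G ξ := by ring
          _ = _ := by
            rw [← ENNReal.ofReal_mul (by positivity), mul_assoc, ← Real.rpow_add hl,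
              ENNReal.ofReal_mul (by norm_num), mul_assoc]
            congr 2
            · norm_num
            · rw [show -2 + (p - 1) = p - 3 by ring]
    _ = 4 * ∫⁻ ξ, ∫⁻ l in Set.Ioi (0:ℝ), H (l, ξ) := by
        rw [lintegral_const_mul' _ _ (by norm_num), lintegral_lintegral_swap]
        exact hHm.aemeasurable
    _ = 4 * ∫⁻ ξ : E3, ENNReal.ofReal ((2 * sph * ‖ξ‖) ^ (p - 2) / (p - 2)) * G ξ := by
        congr 1
        apply lintegral_congr
        intro ξ
        rw [← inner_int hp (by positivity), ← lintegral_mul_const' _ _ (by rw [hG]; exact ENNReal.ofReal_ne_top)]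
        apply lintegral_congr
        intro l
        by_cases h : l ≤ 2 * sph * ‖ξ‖ <;> simp [hH, hT, h]
    _ = 4 * ∫⁻ ξ : E3, ENNReal.ofReal ((2 * sph) ^ (p - 2) / (p - 2)) * 
          ENNReal.ofReal (‖ξ‖ ^ (p - 6) * Real.exp (-(2 * t) * ‖ξ‖ ^ 2)) := by
        congr 1
        apply lintegral_congr_ae
        filter_upwards [Measure.ae_ne volume (0 : E3)] with ξ hξ
        have hξ : 0 < ‖ξ‖ := norm_pos_iff.2 hξ
        rw [hG, ← ENNReal.ofReal_mul (by positivity), ← ENNReal.ofReal_mul (by positivity)]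
        congr 1
        rw [Real.mul_rpow (by positivity) (by positivity), show p - 6 = (p - 2) + (-4) by ring,
          Real.rpow_add hξ]
        ring
    _ = _ := by
        rw [lintegral_const_mul' _ _ ENNReal.ofReal_ne_top, ENNReal.ofReal_mul (by norm_num),
          mul_assoc]
        norm_num

open FourierTransform in
theorem sup_scaled (f : E3 → ℂ) {t M : ℝ} (ht : 0 < t) (hM : 0 ≤ M)
    (hb : ∀ᵐ ξ : E3, ‖f ξ‖ ≤ M * (‖ξ‖ ^ (-2 : ℝ) * Real.exp (-t * ‖ξ‖ ^ 2))) (x : E3) :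
    ‖𝓕 f x‖ₑ ≤ ENNReal.ofReal
      (M * (sph * (1 / 2 * Real.Gamma ((-2 + 3) / 2)) * t ^ (-(-2 + 3 : ℝ) / 2))) := by
  refine (fourier_enorm_le f x).trans ?_
  rw [ENNReal.ofReal_mul hM, ← gauss_lintegral (by norm_num) ht,
    ← lintegral_const_mul' _ _ ENNReal.ofReal_ne_top]
  apply lintegral_mono_ae
  filter_upwards [hb] with ξ hξ
  rw [← ofReal_norm, ← ENNReal.ofReal_mul hM]
  exact ENNReal.ofReal_le_ofReal hξ

/-- constant in the `L^p` bound -/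
def AA (p : ℝ) : ℝ := p * (4 * ((2 * sph) ^ (p - 2) / (p - 2))) *
  (sph * (1 / 2 * Real.Gamma ((p - 3) / 2)) * 2 ^ (-(p - 3) / 2))

theorem AA_pos {p : ℝ} (hp : 3 < p) : 0 < AA p := by
  have hsph := sph_pos
  have hp2 : 0 < p - 2 := by linarith
  have : 0 < Real.Gamma ((p - 3) / 2) := Real.Gamma_pos_of_pos (by linarith)
  unfold AA
  positivity

open FourierTransform in
theorem strong_scaled (f : E3 → ℂ) (hf : Integrable f) {t p M : ℝ} (ht : 0 < t) (hp : 3 < p)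
    (hM : 0 < M)
    (hb : ∀ᵐ ξ : E3, ‖f ξ‖ ≤ M * (‖ξ‖ ^ (-2 : ℝ) * Real.exp (-t * ‖ξ‖ ^ 2))) :
    ∫⁻ x, ENNReal.ofReal (‖𝓕 f x‖ ^ p) ≤
      ENNReal.ofReal (M ^ p * (AA p * t ^ (-(p - 3) / 2))) := by
  have hsph := sph_pos
  have hp2 : 0 < p - 2 := by linarith
  have hb' : ∀ᵐ ξ : E3, ‖M⁻¹ • f ξ‖ ≤ ‖ξ‖ ^ (-2 : ℝ) * Real.exp (-t * ‖ξ‖ ^ 2) := by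
    filter_upwards [hb] with ξ hξ
    rw [norm_smul, Real.norm_of_nonneg (by positivity), inv_mul_le_iff₀ hM]
    exact hξ
  have hs := strong_bound (fun ξ => M⁻¹ • f ξ) (hf.smul M⁻¹) ht hp hb'
  have e : ∀ x, 𝓕 f x = M • 𝓕 (fun ξ => M⁻¹ • f ξ) x := by
    intro x
    simp only [Real.fourier_eq]
    rw [← integral_smul]
    apply integral_congr_ae
    refine Eventually.of_forall fun ξ => ?_
    dsimp only
    rw [smul_comm M, smul_smul, mul_inv_cancel₀ hM.ne', one_smul]
  have e2 : ∀ x, ENNReal.ofReal (‖𝓕 f x‖ ^ p) =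
      ENNReal.ofReal (M ^ p) * ENNReal.ofReal (‖𝓕 (fun ξ => M⁻¹ • f ξ) x‖ ^ p) := by
    intro x
    rw [← ENNReal.ofReal_mul (by positivity), e, norm_smul, Real.norm_of_nonneg hM.le,
      Real.mul_rpow hM.le (norm_nonneg _)]
  simp_rw [e2]
  rw [lintegral_const_mul' _ _ ENNReal.ofReal_ne_top, ENNReal.ofReal_mul (by positivity)]
  gcongr
  refine hs.trans (le_of_eq ?_)
  rw [gauss_lintegral (by linarith) (by positivity), ← ENNReal.ofReal_mul (by positivity)]
  congr 1
  rw [Real.mul_rpow (by norm_num) ht.le, show p - 6 + 3 = p - 3 by ring]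
  unfold AA
  ring

open FourierTransform in
theorem heatFlow_eq (g : E3 → ℂ) (t : ℝ) (x : E3) :
    heatFlow g t x = (((2 * Real.pi) ^ ((3 : ℝ) / 2))⁻¹ : ℝ) •
      𝓕 (fun ξ : E3 => (Real.exp (-t * ‖ξ‖ ^ 2) : ℂ) * g ξ) ((-(2 * Real.pi)⁻¹) • x) := by
  unfold heatFlow
  congr 1
  rw [Real.fourier_eq']
  apply integral_congr_ae
  refine Eventually.of_forall fun ξ => ?_
  simp only [smul_eq_mul]
  rw [mul_assoc]
  congr 2
  rw [inner_smul_right, PiLp.inner_apply]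
  have : ∑ j, inner ℝ (ξ j) (x j) = ∑ j, x j * ξ j := by
    simp
  rw [this, mul_comm Complex.I]
  congr 2
  have := Real.pi_pos
  field_simp

theorem lintegral_smul_comp (F : E3 → ℝ≥0∞) {r : ℝ} (hr : r ≠ 0) :
    ∫⁻ x : E3, F (r • x) = ENNReal.ofReal |(r ^ 3)⁻¹| * ∫⁻ x, F x := by
  have h1 := Measure.map_addHaar_smul (volume : Measure E3) hr
  have h2 := lintegral_map_equiv (μ := (volume : Measure E3)) F
    (Homeomorph.smulOfNeZero r hr).toMeasurableEquiv
  have h3 : ⇑(Homeomorph.smulOfNeZero r hr).toMeasurableEquiv = fun x : E3 => r • x := rfl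
  rw [h3] at h2
  rw [← h2, h1, lintegral_smul_measure]
  simp

/-- **Embedding `PM² ⊂ Ḃ^{-1+3/p,∞}_p(ℝ³)` for `3 < p ≤ ∞`:** there is `C = C(p)`
such that for every `g` with `M = ess sup |ξ|²|g(ξ)| < ∞` and every `t > 0` the
Fourier integral defining `S_t g` converges absolutely and
`‖S_t g‖_{L^p} ≤ C t^{-(1-3/p)/2} M`. -/
theorem PM2_subset_Besov (p : ℝ≥0∞) (hp : 3 < p) :
    ∃ C : ℝ, 0 < C ∧
      ∀ g : E3 → ℂ, Measurable g → PMnormC 2 g < ⊤ → ∀ t : ℝ, 0 < t →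
        (∀ x : E3, Integrable (fun ξ : E3 =>
            Complex.exp (Complex.I * ((∑ j, x j * ξ j : ℝ) : ℂ)) *
              (Real.exp (-t * ‖ξ‖ ^ 2) : ℂ) * g ξ)) ∧
        eLpNorm (heatFlow g t) p volume ≤
          ENNReal.ofReal (C * t ^ (-(1 - 3 / p.toReal) / 2)) * PMnormC 2 g := by
  have hsph := sph_pos
  have hpi := Real.pi_pos
  set c : ℝ := ((2 * Real.pi) ^ ((3 : ℝ) / 2))⁻¹ with hc
  have hcpos : 0 < c := by positivity
  have hbound : ∀ g : E3 → ℂ, PMnormC 2 g < ⊤ → ∀ t : ℝ, 0 < t →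
      ∀ᵐ ξ : E3, ‖(Real.exp (-t * ‖ξ‖ ^ 2) : ℂ) * g ξ‖ ≤
        (PMnormC 2 g).toReal * (‖ξ‖ ^ (-2 : ℝ) * Real.exp (-t * ‖ξ‖ ^ 2)) := by
    intro g hg t ht
    have h1 := ENNReal.ae_le_essSup (μ := (volume : Measure E3))
      (fun ξ : E3 => ENNReal.ofReal (‖ξ‖ ^ (2:ℝ) * ‖g ξ‖))
    filter_upwards [h1, Measure.ae_ne volume (0 : E3)] with ξ h hξ
    have hξ : 0 < ‖ξ‖ := norm_pos_iff.2 hξ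
    have h' : ‖ξ‖ ^ (2:ℝ) * ‖g ξ‖ ≤ (PMnormC 2 g).toReal :=
      (ENNReal.ofReal_le_iff_le_toReal hg.ne).1 h
    rw [norm_mul, Complex.norm_real, Real.norm_of_nonneg (Real.exp_pos _).le, Real.rpow_neg hξ.le,
      mul_comm, ← mul_assoc]
    gcongr
    rw [← div_eq_mul_inv, le_div_iff₀ (by positivity), mul_comm]
    exact h'
  have hint : ∀ g : E3 → ℂ, Measurable g → PMnormC 2 g < ⊤ → ∀ t : ℝ, 0 < t →
      Integrable (fun ξ : E3 => (Real.exp (-t * ‖ξ‖ ^ 2) : ℂ) * g ξ) := by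
    intro g hgm hg t ht
    refine Integrable.mono' ((gauss_integrable (s := -2) (by norm_num) ht).const_mul _) ?_
      (hbound g hg t ht)
    apply Measurable.aestronglyMeasurable
    fun_prop
  have hall : ∀ g : E3 → ℂ, Measurable g → PMnormC 2 g < ⊤ → ∀ t : ℝ, 0 < t →
      (∀ x : E3, Integrable (fun ξ : E3 =>
            Complex.exp (Complex.I * ((∑ j, x j * ξ j : ℝ) : ℂ)) *
              (Real.exp (-t * ‖ξ‖ ^ 2) : ℂ) * g ξ)) := by
    intro g hgm hg t ht x
    refine Integrable.mono' (hint g hgm hg t ht).norm ?_ ?_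
    · apply Measurable.aestronglyMeasurable
      fun_prop
    · refine Eventually.of_forall fun ξ => ?_
      rw [mul_assoc, norm_mul, mul_comm Complex.I, Complex.norm_exp_ofReal_mul_I, one_mul]
  have hzero : ∀ g : E3 → ℂ, PMnormC 2 g < ⊤ → ∀ t : ℝ, 0 < t → (PMnormC 2 g).toReal = 0 →
      heatFlow g t = 0 := by
    intro g hg t ht h0
    have := hbound g hg t ht
    rw [h0] at this
    ext x
    unfold heatFlow
    rw [integral_eq_zero_of_ae]
    · simp
    · filter_upwards [this] with ξ hξ
      rw [zero_mul, norm_le_zero_iff] at hξ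
      rw [mul_assoc, hξ]
      simp
  rcases eq_or_ne p ⊤ with rfl | hpt
  · have hG : 0 < Real.Gamma ((-2 + 3) / 2) := Real.Gamma_pos_of_pos (by norm_num)
    refine ⟨c * (sph * (1 / 2 * Real.Gamma ((-2 + 3) / 2))), by positivity, ?_⟩
    intro g hgm hg t ht
    refine ⟨hall g hgm hg t ht, ?_⟩
    rw [eLpNorm_exponent_top]
    apply eLpNormEssSup_le_of_ae_enorm_bound
    refine Eventually.of_forall fun x => ?_
    have hx := sup_scaled _ ht ENNReal.toReal_nonneg (hbound g hg t ht) ((-(2 * Real.pi)⁻¹) • x)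
    rw [heatFlow_eq, enorm_smul, Real.enorm_of_nonneg hcpos.le]
    refine (mul_le_mul_right hx _).trans (le_of_eq ?_)
    rw [← ENNReal.ofReal_mul hcpos.le]
    conv_rhs => rw [← ENNReal.ofReal_toReal hg.ne]
    rw [← ENNReal.ofReal_mul (by positivity)]
    congr 1
    rw [show (-(1 - 3 / (⊤ : ℝ≥0∞).toReal) / 2) = -(-2 + 3 : ℝ) / 2 by norm_num]
    ring
  · set q := p.toReal with hq
    have hq3 : 3 < q := by
      have := (ENNReal.toReal_lt_toReal (by norm_num) hpt).2 hp
      simpa using this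
    have hA := AA_pos hq3
    refine ⟨(c ^ q * (2 * Real.pi) ^ 3 * AA q) ^ (1 / q), by positivity, ?_⟩
    intro g hgm hg t ht
    refine ⟨hall g hgm hg t ht, ?_⟩
    rcases ENNReal.toReal_nonneg (a := PMnormC 2 g) |>.eq_or_lt with h0 | hM
    · rw [hzero g hg t ht h0.symm]
      simp
    have hs := strong_scaled _ (hint g hgm hg t ht) ht hq3 hM (hbound g hg t ht)
    set M := (PMnormC 2 g).toReal with hMdef
    rw [eLpNorm_eq_lintegral_rpow_enorm_toReal (by rintro rfl; simp at hp) hpt, ← hq]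
    have e : ∀ x, ‖heatFlow g t x‖ₑ ^ q = ENNReal.ofReal (c ^ q) * ENNReal.ofReal
        (‖FourierTransform.fourier (fun ξ : E3 => (Real.exp (-t * ‖ξ‖ ^ 2) : ℂ) * g ξ)
          ((-(2 * Real.pi)⁻¹) • x)‖ ^ q) := by
      intro x
      rw [heatFlow_eq, ← ofReal_norm, norm_smul, Real.norm_of_nonneg hcpos.le,
        ENNReal.ofReal_rpow_of_nonneg (by positivity) (by linarith),
        Real.mul_rpow hcpos.le (norm_nonneg _), ENNReal.ofReal_mul (by positivity)]
    simp_rw [e]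
    rw [lintegral_const_mul' _ _ ENNReal.ofReal_ne_top,
      lintegral_smul_comp (fun y => ENNReal.ofReal (‖FourierTransform.fourier
        (fun ξ : E3 => (Real.exp (-t * ‖ξ‖ ^ 2) : ℂ) * g ξ) y‖ ^ q)) (by
          rw [neg_ne_zero]; positivity)]
    have hpi3 : |((-(2 * Real.pi)⁻¹) ^ 3)⁻¹| = (2 * Real.pi) ^ 3 := by
      rw [abs_inv, abs_pow, abs_neg, abs_of_pos (by positivity), inv_pow, inv_inv]
    rw [hpi3]
    calc _ ≤ (ENNReal.ofReal (c ^ q) * (ENNReal.ofReal ((2 * Real.pi) ^ 3) *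
          ENNReal.ofReal (M ^ q * (AA q * t ^ (-(q - 3) / 2))))) ^ (1 / q) := by
          gcongr
      _ = ENNReal.ofReal ((c ^ q * (2 * Real.pi) ^ 3 * AA q) ^ (1 / q) *
            t ^ (-(1 - 3 / q) / 2)) * ENNReal.ofReal M := by
          rw [← ENNReal.ofReal_mul (by positivity), ← ENNReal.ofReal_mul (by positivity),
            ← ENNReal.ofReal_mul (by positivity),
            ENNReal.ofReal_rpow_of_nonneg (by positivity) (by positivity)]
          congr 1
          rw [show c ^ q * ((2 * Real.pi) ^ 3 * (M ^ q * (AA q * t ^ (-(q - 3) / 2)))) =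
            (c ^ q * (2 * Real.pi) ^ 3 * AA q) * t ^ (-(q - 3) / 2) * M ^ q by ring,
            Real.mul_rpow (by positivity) (by positivity),
            Real.mul_rpow (by positivity) (by positivity), ← Real.rpow_mul ht.le,
            ← Real.rpow_mul hM.le, mul_one_div_cancel (by linarith), Real.rpow_one]
          congr 3
          field_simp
      _ = _ := by rw [hMdef, ENNReal.ofReal_toReal hg.ne]
end
end

section
/- Let a ∈ [2,3). There exists a constant η_a > 0 with the following property. Let û, v̂ : ℝ³ × (0,∞) → ℂ³ be jointly measurable with M := sup_{t>0} ess sup_ξ |ξ|² |û(ξ,t)| < ∞ and N := sup_{t>0} t^{a/2−1} ess sup_ξ |ξ|^a |v̂(ξ,t)| < ∞. Then for every t > 0 and almost every ξ, the convolution integrals converge absolutely (with ∫_{ℝ³} |û(ξ−z,τ)||v̂(z,τ)| dz ≤ C |ξ|^{1−a} M N τ^{1−a/2} for a constant C depending only on a), and t^{a/2−1} |ξ|^a | ∫₀ᵗ e^{−(t−τ)|ξ|²} P̂(ξ)( iξ·Ŵ[û(·,τ),v̂(·,τ)](ξ) ) dτ | ≤ η_a M N. -/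
open MeasureTheory Filter
open scoped ENNReal

noncomputable section

/-- The weighted norm `|||v|||_a = sup_{t>0} t^{a/2−1} ‖v(t)‖_{PM^a}`. -/
def wsupPM (a : ℝ) (u : E3 → ℝ → V3) : ℝ≥0∞ :=
  ⨆ (t : ℝ) (_ : 0 < t), ENNReal.ofReal (t ^ (a / 2 - 1)) * PMnorm a (fun ξ => u ξ t)

/-- `sup_{t > 0} ‖u(t)‖_{PM²}`. -/
def supPMpos (u : E3 → ℝ → V3) : ℝ≥0∞ :=
  ⨆ (t : ℝ) (_ : 0 < t), PMnorm 2 (fun ξ => u ξ t)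


lemma aux_ball (b : ℝ) (hb : b < 3) :
    Integrable (fun w : E3 => (Metric.ball (0:E3) 1).indicator (fun w => ‖w‖ ^ (-b)) w) := by
  rw [integrable_indicator_iff measurableSet_ball]
  have hfin : Module.finrank ℝ E3 = 3 := by simp
  refine integrableOn_ball_of_norm_le_rpow (C := 1) (α := b) ?_ ?_ ?_ ?_
  · rw [hfin]; norm_num
  · rw [hfin]; push_cast; linarith
  · refine Eventually.of_forall fun x => ?_
    rw [one_mul, Real.norm_of_nonneg (by positivity)]
  · exact (measurable_norm.pow_const _).aestronglyMeasurable

lemma aux_pt (a : ℝ) (ha : 2 ≤ a) (ha' : a < 3) (e w : E3) (he : ‖e‖ = 1) :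
    ‖e - w‖ ^ (-2 : ℝ) * ‖w‖ ^ (-a) ≤
      4 * (Metric.ball (0:E3) 1).indicator (fun w => ‖w‖ ^ (-a)) w
      + 8 * (Metric.ball (0:E3) 1).indicator (fun w => ‖w‖ ^ (-2:ℝ)) (e - w)
      + 9 * 3 ^ (2 + a) * (1 + ‖w‖) ^ (-(2 + a)) := by
  have h1 : 0 ≤ (Metric.ball (0:E3) 1).indicator (fun w => ‖w‖ ^ (-a)) w :=
    Set.indicator_nonneg (fun _ _ => by positivity) _
  have h2 : 0 ≤ (Metric.ball (0:E3) 1).indicator (fun w => ‖w‖ ^ (-2:ℝ)) (e - w) :=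
    Set.indicator_nonneg (fun _ _ => by positivity) _
  have h3 : 0 ≤ 9 * 3 ^ (2 + a) * (1 + ‖w‖) ^ (-(2 + a)) := by positivity
  have htri : ‖e‖ ≤ ‖e - w‖ + ‖w‖ := by simpa using norm_add_le (e - w) w
  have htri2 : ‖w‖ ≤ ‖e - w‖ + ‖e‖ := by
    rw [← norm_sub_rev w e]; simpa using norm_add_le (w - e) e
  rw [he] at htri htri2
  by_cases c1 : ‖w‖ < 1/2
  · have hm : w ∈ Metric.ball (0:E3) 1 := by simp; linarith
    rw [Set.indicator_of_mem hm] at h1 ⊢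
    have : ‖e - w‖ ^ (-2 : ℝ) ≤ 4 := by
      calc _ ≤ (1/2:ℝ) ^ (-2:ℝ) :=
            Real.rpow_le_rpow_of_nonpos (by norm_num) (by linarith) (by norm_num)
        _ = 4 := by
            rw [Real.rpow_neg (by norm_num)]; norm_num
    have := mul_le_mul_of_nonneg_right this h1
    linarith
  by_cases c2 : ‖e - w‖ < 1/2
  · have hm : e - w ∈ Metric.ball (0:E3) 1 := by rw [mem_ball_zero_iff]; linarith
    rw [Set.indicator_of_mem hm] at h2 ⊢
    have : ‖w‖ ^ (-a) ≤ 8 := by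
      calc _ ≤ (1/2:ℝ) ^ (-a) :=
            Real.rpow_le_rpow_of_nonpos (by norm_num) (by linarith) (by linarith)
        _ ≤ (1/2:ℝ) ^ (-3:ℝ) :=
            Real.rpow_le_rpow_of_exponent_ge (by norm_num) (by norm_num) (by linarith)
        _ = 8 := by
            rw [Real.rpow_neg (by norm_num)]; norm_num
    have := mul_le_mul_of_nonneg_left this h2
    linarith
  have hw : 0 < ‖w‖ := by linarith
  have A : ‖e - w‖ ^ (-2 : ℝ) ≤ 9 * ‖w‖ ^ (-2:ℝ) := by
    calc _ ≤ (‖w‖/3) ^ (-2:ℝ) :=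
          Real.rpow_le_rpow_of_nonpos (by linarith) (by linarith) (by norm_num)
      _ = 9 * ‖w‖ ^ (-2:ℝ) := by
          rw [Real.rpow_neg (by positivity), Real.rpow_neg (by positivity)]
          norm_num; field_simp; norm_num
  have B : ‖w‖ ^ (-(2+a)) ≤ 3 ^ (2+a) * (1 + ‖w‖) ^ (-(2 + a)) := by
    calc _ ≤ ((1+‖w‖)/3) ^ (-(2+a)) :=
          Real.rpow_le_rpow_of_nonpos (by linarith) (by linarith) (by linarith)
      _ = _ := by
          rw [Real.div_rpow (by positivity) (by positivity), Real.rpow_neg (x := 3) (by positivity)]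
          field_simp
  calc _ ≤ 9 * ‖w‖ ^ (-2:ℝ) * ‖w‖ ^ (-a) := by gcongr
    _ = 9 * ‖w‖ ^ (-(2+a)) := by
        rw [mul_assoc, ← Real.rpow_add hw]; ring_nf
    _ ≤ 9 * (3 ^ (2+a) * (1 + ‖w‖) ^ (-(2 + a))) := by gcongr
    _ ≤ _ := by linarith

lemma aux_unit (a : ℝ) (ha : 2 ≤ a) (ha' : a < 3) :
    ∃ C : ℝ, 0 < C ∧ ∀ e : E3, ‖e‖ = 1 →
      ∫⁻ w : E3, ENNReal.ofReal (‖e - w‖ ^ (-2 : ℝ) * ‖w‖ ^ (-a)) ≤ ENNReal.ofReal C := by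
  have i1 := (aux_ball a ha').const_mul 4
  have i2 := (aux_ball 2 (by norm_num)).const_mul 8
  have i3 : Integrable (fun w : E3 => 9 * 3 ^ (2 + a) * (1 + ‖w‖) ^ (-(2 + a))) :=
    (integrable_one_add_norm (by simp; linarith)).const_mul _
  refine ⟨max 1 ((∫ w : E3, 4 * (Metric.ball (0:E3) 1).indicator (fun w => ‖w‖ ^ (-a)) w)
    + (∫ w : E3, 8 * (Metric.ball (0:E3) 1).indicator (fun w => ‖w‖ ^ (-2:ℝ)) w)
    + ∫ w : E3, 9 * 3 ^ (2 + a) * (1 + ‖w‖) ^ (-(2 + a))), by positivity, fun e he => ?_⟩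
  have i2' := i2.comp_sub_left e
  have i12 : Integrable (fun w : E3 => 4 * (Metric.ball (0:E3) 1).indicator (fun w => ‖w‖ ^ (-a)) w
      + 8 * (Metric.ball (0:E3) 1).indicator (fun w => ‖w‖ ^ (-2:ℝ)) (e - w)) := i1.add i2'
  have i123 : Integrable (fun w : E3 => 4 * (Metric.ball (0:E3) 1).indicator (fun w => ‖w‖ ^ (-a)) w
      + 8 * (Metric.ball (0:E3) 1).indicator (fun w => ‖w‖ ^ (-2:ℝ)) (e - w)
      + 9 * 3 ^ (2 + a) * (1 + ‖w‖) ^ (-(2 + a))) := i12.add i3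
  calc _ ≤ ∫⁻ w : E3, ENNReal.ofReal (4 * (Metric.ball (0:E3) 1).indicator (fun w => ‖w‖ ^ (-a)) w
      + 8 * (Metric.ball (0:E3) 1).indicator (fun w => ‖w‖ ^ (-2:ℝ)) (e - w)
      + 9 * 3 ^ (2 + a) * (1 + ‖w‖) ^ (-(2 + a))) :=
        lintegral_mono fun w => ENNReal.ofReal_le_ofReal (aux_pt a ha ha' e w he)
    _ = ENNReal.ofReal (∫ w : E3, (4 * (Metric.ball (0:E3) 1).indicator (fun w => ‖w‖ ^ (-a)) w
      + 8 * (Metric.ball (0:E3) 1).indicator (fun w => ‖w‖ ^ (-2:ℝ)) (e - w)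
      + 9 * 3 ^ (2 + a) * (1 + ‖w‖) ^ (-(2 + a)))) := by
        rw [ofReal_integral_eq_lintegral_ofReal i123]
        refine Eventually.of_forall fun w => ?_
        exact le_trans (by positivity) (aux_pt a ha ha' e w he)
    _ ≤ _ := by
        refine ENNReal.ofReal_le_ofReal (le_trans (le_of_eq ?_) (le_max_right _ _))
        rw [integral_add i12 i3, integral_add i1 i2',
          integral_sub_left_eq_self (fun w => 8 * (Metric.ball (0:E3) 1).indicator (fun w => ‖w‖ ^ (-2:ℝ)) w)]

lemma aux_conv (a : ℝ) (ha : 2 ≤ a) (ha' : a < 3) :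
    ∃ C : ℝ, 0 < C ∧ ∀ ξ : E3, ξ ≠ 0 →
      ∫⁻ z : E3, ENNReal.ofReal (‖ξ - z‖ ^ (-2 : ℝ) * ‖z‖ ^ (-a))
        ≤ ENNReal.ofReal (C * ‖ξ‖ ^ (1 - a)) := by
  obtain ⟨C, hC, h⟩ := aux_unit a ha ha'
  refine ⟨C, hC, fun ξ hξ => ?_⟩
  have hr : 0 < ‖ξ‖ := norm_pos_iff.2 hξ
  set r := ‖ξ‖ with hrdef
  obtain ⟨e, he, hξe⟩ : ∃ e : E3, ‖e‖ = 1 ∧ ξ = r • e := by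
    refine ⟨r⁻¹ • ξ, ?_, ?_⟩
    · rw [norm_smul, Real.norm_of_nonneg (by positivity), ← hrdef]; field_simp
    · rw [smul_smul, mul_inv_cancel₀ hr.ne', one_smul]
  have hmeas : Measurable (fun z : E3 => ENNReal.ofReal (‖ξ - z‖ ^ (-2 : ℝ) * ‖z‖ ^ (-a))) := by
    fun_prop
  have hvol := Measure.map_addHaar_smul (volume : Measure E3) hr.ne'
  have hfin : Module.finrank ℝ E3 = 3 := by simp
  rw [hfin, abs_of_pos (by positivity)] at hvol
  have key : ∫⁻ z : E3, ENNReal.ofReal (‖ξ - r • z‖ ^ (-2 : ℝ) * ‖r • z‖ ^ (-a)) =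
      ENNReal.ofReal ((r^3)⁻¹) * ∫⁻ z : E3, ENNReal.ofReal (‖ξ - z‖ ^ (-2 : ℝ) * ‖z‖ ^ (-a)) := by
    rw [← smul_eq_mul, ← lintegral_smul_measure, ← hvol, lintegral_map hmeas (by fun_prop)]
  have e2 : ∀ z : E3, ENNReal.ofReal (‖ξ - r • z‖ ^ (-2 : ℝ) * ‖r • z‖ ^ (-a)) =
      ENNReal.ofReal (r ^ (-2-a)) * ENNReal.ofReal (‖e - z‖ ^ (-2 : ℝ) * ‖z‖ ^ (-a)) := by
    intro z
    rw [← ENNReal.ofReal_mul (by positivity)]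
    congr 1
    rw [hξe, ← smul_sub, norm_smul, norm_smul, Real.norm_of_nonneg hr.le,
      Real.mul_rpow hr.le (norm_nonneg _), Real.mul_rpow hr.le (norm_nonneg _),
      sub_eq_add_neg (-2:ℝ) a, Real.rpow_add hr]
    ring_nf
  simp_rw [e2] at key
  rw [lintegral_const_mul _ (by fun_prop)] at key
  have k2 : ∫⁻ z : E3, ENNReal.ofReal (‖ξ - z‖ ^ (-2 : ℝ) * ‖z‖ ^ (-a)) =
      ENNReal.ofReal (r^3) * (ENNReal.ofReal (r ^ (-2-a)) *
        ∫⁻ z : E3, ENNReal.ofReal (‖e - z‖ ^ (-2 : ℝ) * ‖z‖ ^ (-a))) := by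
    rw [key, ← mul_assoc, ← ENNReal.ofReal_mul (by positivity), mul_inv_cancel₀ (by positivity)]
    simp
  rw [k2]
  calc _ ≤ ENNReal.ofReal (r^3) * (ENNReal.ofReal (r ^ (-2-a)) * ENNReal.ofReal C) := by
        gcongr; exact h e he
    _ = _ := by
        rw [← ENNReal.ofReal_mul (by positivity), ← ENNReal.ofReal_mul (by positivity)]
        congr 1
        rw [← mul_assoc, mul_comm C, ← Real.rpow_natCast, ← Real.rpow_add hr]
        norm_num; left; ring_nf

lemma aux_time_pt (a : ℝ) (ha : 2 ≤ a) (t τ s : ℝ) (hτ : 0 < τ) (hτt : τ ≤ t) (hs : 0 ≤ s) :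
    s * Real.exp (-(t - τ) * s) * τ ^ (1 - a/2) ≤
      (2 / t) * τ ^ (1 - a/2) + (t/2) ^ (1 - a/2) * (s * Real.exp (-(t - τ) * s)) := by
  have ht : 0 < t := by linarith
  by_cases h : τ ≤ t/2
  · have hd : 0 < t - τ := by linarith
    have h1 : s * Real.exp (-(t - τ) * s) ≤ 2 / t := by
      have := Real.mul_exp_neg_le_exp_neg_one ((t-τ)*s)
      have h2 : Real.exp (-1) ≤ 1 := by simp
      rw [le_div_iff₀ ht]
      have h3 : (t-τ) * (s * Real.exp (-(t - τ) * s)) ≤ 1 := by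
        rw [neg_mul, ← mul_assoc]; linarith
      have h4 : 0 ≤ s * Real.exp (-(t - τ) * s) := by positivity
      nlinarith
    have := mul_le_mul_of_nonneg_right h1 (Real.rpow_nonneg hτ.le (1 - a/2))
    have h5 : 0 ≤ (t/2) ^ (1 - a/2) * (s * Real.exp (-(t - τ) * s)) := by positivity
    linarith
  · have h1 : τ ^ (1 - a/2) ≤ (t/2) ^ (1 - a/2) :=
      Real.rpow_le_rpow_of_nonpos (by linarith) (by linarith) (by linarith)
    have h2 := mul_le_mul_of_nonneg_right h1 (a := s * Real.exp (-(t - τ) * s)) (by positivity)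
    have : 0 ≤ (2 / t) * τ ^ (1 - a/2) := by positivity
    linarith

lemma aux_time (a : ℝ) (ha : 2 ≤ a) (ha' : a < 3) (t s : ℝ) (ht : 0 < t) :
    IntervalIntegrable (fun τ => (2 / t) * τ ^ (1 - a/2)
      + (t/2) ^ (1 - a/2) * (s * Real.exp (-(t - τ) * s))) volume 0 t ∧
    ∫ τ in (0:ℝ)..t, ((2 / t) * τ ^ (1 - a/2)
      + (t/2) ^ (1 - a/2) * (s * Real.exp (-(t - τ) * s))) ≤ 6 * t ^ (1 - a/2) := by
  have i1 : IntervalIntegrable (fun τ => (2 / t) * τ ^ (1 - a/2)) volume 0 t :=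
    (intervalIntegral.intervalIntegrable_rpow' (by linarith)).const_mul _
  have i2 : IntervalIntegrable (fun τ => (t/2) ^ (1 - a/2) * (s * Real.exp (-(t - τ) * s)))
      volume 0 t := Continuous.intervalIntegrable (by fun_prop) _ _
  refine ⟨i1.add i2, ?_⟩
  rw [intervalIntegral.integral_add i1 i2, intervalIntegral.integral_const_mul,
    intervalIntegral.integral_const_mul, integral_rpow (Or.inl (by linarith)),
    Real.zero_rpow (by linarith)]
  have hint : ∫ τ in (0:ℝ)..t, s * Real.exp (-(t - τ) * s) = 1 - Real.exp (-t * s) := by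
    rw [intervalIntegral.integral_eq_sub_of_hasDerivAt (f := fun τ => Real.exp (-(t - τ) * s))]
    · simp
    · intro x _
      have : HasDerivAt (fun τ => -(t - τ) * s) s x := by
        simpa using (((hasDerivAt_id x).const_sub t).neg).mul_const s
      simpa [mul_comm] using this.exp
    · exact Continuous.intervalIntegrable (by fun_prop) _ _
  rw [hint]
  have e1 : (t/2) ^ (1 - a/2) ≤ 2 * t ^ (1 - a/2) := by
    rw [div_eq_mul_inv, Real.mul_rpow ht.le (by norm_num), mul_comm]
    gcongr
    calc (2⁻¹:ℝ) ^ (1 - a/2) ≤ (2⁻¹:ℝ) ^ (-1:ℝ) :=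
          Real.rpow_le_rpow_of_exponent_ge (by norm_num) (by norm_num) (by linarith)
      _ = 2 := by rw [Real.rpow_neg_one]; norm_num
  have e2 : 2 / t * ((t ^ (1 - a/2 + 1) - 0) / (1 - a/2 + 1)) ≤ 4 * t ^ (1 - a/2) := by
    rw [Real.rpow_add_one ht.ne']
    have hp : 0 ≤ t ^ (1 - a/2) := by positivity
    have hq : 1/2 ≤ 1 - a/2 + 1 := by linarith
    have : 2 / t * ((t ^ (1 - a/2) * t - 0) / (1 - a/2 + 1))
        = 2 * t ^ (1 - a/2) / (1 - a/2 + 1) := by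
      field_simp; simp
    rw [this, div_le_iff₀ (by linarith)]
    nlinarith
  have e3 : (t/2) ^ (1 - a/2) * (1 - Real.exp (-t * s)) ≤ (t/2) ^ (1 - a/2) :=
    mul_le_of_le_one_right (by positivity) (by have := Real.exp_pos (-t * s); linarith)
  linarith

lemma aux_ae (b : ℝ) (g : E3 → V3) (K : ℝ) (hK : 0 ≤ K) (h : PMnorm b g ≤ ENNReal.ofReal K) :
    ∀ᵐ z : E3, ‖g z‖ ≤ K * ‖z‖ ^ (-b) := by
  have h0 : ∀ᵐ z : E3, z ≠ 0 := by
    simp [ae_iff]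
  filter_upwards [ENNReal.ae_le_essSup (μ := (volume : Measure E3))
    (fun ξ : E3 => ENNReal.ofReal (‖ξ‖ ^ b * ‖g ξ‖)), h0] with z hz hz0
  have h1 := (ENNReal.ofReal_le_ofReal_iff hK).1 (hz.trans h)
  have hz' : 0 < ‖z‖ := norm_pos_iff.2 hz0
  rw [Real.rpow_neg hz'.le, ← div_eq_mul_inv, le_div_iff₀ (by positivity), mul_comm]
  exact h1

lemma aux_conv_uv (a C : ℝ)
    (hC : ∀ ξ : E3, ξ ≠ 0 →
      ∫⁻ z : E3, ENNReal.ofReal (‖ξ - z‖ ^ (-2 : ℝ) * ‖z‖ ^ (-a))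
        ≤ ENNReal.ofReal (C * ‖ξ‖ ^ (1 - a))) (hC0 : 0 < C)
    (f g : E3 → V3) (M N : ℝ) (hM : 0 ≤ M) (hN : 0 ≤ N)
    (hf : ∀ᵐ z : E3, ‖f z‖ ≤ M * ‖z‖ ^ (-2 : ℝ)) (hg : ∀ᵐ z : E3, ‖g z‖ ≤ N * ‖z‖ ^ (-a))
    (ξ : E3) (hξ : ξ ≠ 0) (j k : Fin 3) :
    ∫⁻ z : E3, ENNReal.ofReal (‖f (ξ - z) j‖ * ‖g z k‖) ≤
      ENNReal.ofReal (M * N * (C * ‖ξ‖ ^ (1 - a))) := by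
  have hf' : ∀ᵐ z : E3, ‖f (ξ - z)‖ ≤ M * ‖ξ - z‖ ^ (-2 : ℝ) :=
    (Measure.measurePreserving_sub_left volume ξ).quasiMeasurePreserving.ae hf
  calc _ ≤ ∫⁻ z : E3, ENNReal.ofReal (M * N) *
          ENNReal.ofReal (‖ξ - z‖ ^ (-2 : ℝ) * ‖z‖ ^ (-a)) := by
        refine lintegral_mono_ae ?_
        filter_upwards [hf', hg] with z h1 h2
        rw [← ENNReal.ofReal_mul (by positivity)]
        refine ENNReal.ofReal_le_ofReal ?_
        calc _ ≤ (M * ‖ξ - z‖ ^ (-2 : ℝ)) * (N * ‖z‖ ^ (-a)) :=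
              mul_le_mul ((norm_le_pi_norm _ j).trans h1) ((norm_le_pi_norm _ k).trans h2)
                (norm_nonneg _) (by positivity)
          _ = _ := by ring
    _ = ENNReal.ofReal (M * N) *
          ∫⁻ z : E3, ENNReal.ofReal (‖ξ - z‖ ^ (-2 : ℝ) * ‖z‖ ^ (-a)) := by
        rw [lintegral_const_mul _ (by fun_prop)]
    _ ≤ ENNReal.ofReal (M * N) * ENNReal.ofReal (C * ‖ξ‖ ^ (1 - a)) := by
        gcongr; exact hC ξ hξ
    _ = _ := by rw [← ENNReal.ofReal_mul (by positivity)]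

lemma aux_coord (ξ : E3) (k : Fin 3) : ‖(ξ k : ℂ)‖ ≤ ‖ξ‖ := by
  rw [Complex.norm_real]
  exact PiLp.norm_apply_le ξ k

lemma aux_leray (ξ : E3) (w : V3) : ‖(LerayP ξ).mulVec w‖ ≤ 6 * ‖w‖ := by
  have hent : ∀ j k, ‖LerayP ξ j k‖ ≤ 2 := by
    intro j k
    unfold LerayP
    refine (norm_sub_le _ _).trans ?_
    have h1 : ‖(if j = k then (1:ℂ) else 0)‖ ≤ 1 := by split_ifs <;> simp
    have h2 : ‖((ξ j : ℂ) * (ξ k : ℂ)) / ((‖ξ‖ : ℂ) ^ 2)‖ ≤ 1 := by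
      rw [norm_div, norm_mul, norm_pow, Complex.norm_real, Complex.norm_real, Complex.norm_real,
        norm_norm]
      refine div_le_one_of_le₀ ?_ (by positivity)
      rw [sq]
      exact mul_le_mul (PiLp.norm_apply_le ξ j) (PiLp.norm_apply_le ξ k) (norm_nonneg _)
        (norm_nonneg _)
    linarith
  rw [pi_norm_le_iff_of_nonneg (by positivity)]
  intro j
  rw [Matrix.mulVec, dotProduct]
  refine (norm_sum_le _ _).trans ?_
  calc _ ≤ ∑ k : Fin 3, 2 * ‖w‖ := by
        refine Finset.sum_le_sum fun k _ => ?_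
        rw [norm_mul]
        exact mul_le_mul (hent j k) (norm_le_pi_norm w k) (norm_nonneg _) (by norm_num)
    _ = _ := by simp; ring

lemma aux_ixW (f g : E3 → V3) (ξ : E3) (K : ℝ) (hK : 0 ≤ K)
    (h : ∀ j k, ∫⁻ z : E3, ENNReal.ofReal (‖f (ξ - z) j‖ * ‖g z k‖) ≤ ENNReal.ofReal K) :
    ‖ixW f g ξ‖ ≤ 3 * (‖ξ‖ * K) := by
  have hW : ∀ j k, ‖Wconv f g ξ j k‖ ≤ K := by
    intro j k
    unfold Wconv
    rw [norm_smul]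
    have h1 : ‖∫ z : E3, f (ξ - z) j * g z k‖ ≤ K := by
      have := (enorm_integral_le_lintegral_enorm (μ := volume)
        (fun z : E3 => f (ξ - z) j * g z k)).trans
        (le_of_eq_of_le (by simp only [← ofReal_norm, norm_mul]) (h j k))
      rw [← ofReal_norm] at this
      exact (ENNReal.ofReal_le_ofReal_iff hK).1 this
    have h2 : ‖((2 * Real.pi) ^ ((3 : ℝ) / 2))⁻¹‖ ≤ 1 := by
      rw [Real.norm_of_nonneg (by positivity)]
      refine inv_le_one_of_one_le₀ (Real.one_le_rpow ?_ (by norm_num))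
      have := Real.pi_gt_three
      linarith
    calc _ ≤ 1 * K := mul_le_mul h2 h1 (norm_nonneg _) (by norm_num)
      _ = K := one_mul K
  rw [pi_norm_le_iff_of_nonneg (by positivity)]
  intro j
  unfold ixW
  refine (norm_sum_le _ _).trans ?_
  calc _ ≤ ∑ k : Fin 3, ‖ξ‖ * K := by
        refine Finset.sum_le_sum fun k _ => ?_
        rw [norm_mul, norm_mul, Complex.norm_I, one_mul]
        exact mul_le_mul (aux_coord ξ k) (hW j k) (norm_nonneg _) (norm_nonneg _)
    _ = _ := by simp

/-- **Weighted bilinear estimate in the `PM^a` scale:** for `2 ≤ a < 3` there are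
constants `η_a, C > 0` such that for `û` bounded in `PM²` (`M`) and `v̂` with finite
weighted norm `N = sup_{t>0} t^{a/2−1}‖v̂(t)‖_{PM^a}`, the convolutions converge
absolutely with `∫|û(ξ−z,τ)||v̂(z,τ)|dz ≤ C |ξ|^{1−a} M N τ^{1−a/2}`, and
`t^{a/2−1} |ξ|^a |∫₀ᵗ e^{−(t−τ)|ξ|²} P̂(ξ)(iξ·Ŵ[û(τ),v̂(τ)](ξ)) dτ| ≤ η_a M N`. -/
theorem weighted_bilinear_estimate (a : ℝ) (ha : 2 ≤ a) (ha' : a < 3) :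
    ∃ ηa C : ℝ, 0 < ηa ∧ 0 < C ∧
      ∀ u v : E3 → ℝ → V3,
        Measurable (fun p : E3 × ℝ => u p.1 p.2) →
        Measurable (fun p : E3 × ℝ => v p.1 p.2) →
        supPMpos u ≠ ⊤ → wsupPM a v ≠ ⊤ →
        (∀ τ : ℝ, 0 < τ → ∀ᵐ ξ : E3, ∀ j k : Fin 3,
            ∫⁻ z : E3, ENNReal.ofReal (‖u (ξ - z) τ j‖ * ‖v z τ k‖) ≤
              ENNReal.ofReal (C * ‖ξ‖ ^ (1 - a) * τ ^ (1 - a / 2)) *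
                supPMpos u * wsupPM a v) ∧
        (∀ t : ℝ, 0 < t →
            ENNReal.ofReal (t ^ (a / 2 - 1)) * PMnorm a (fun ξ => Bterm u v ξ t) ≤
              ENNReal.ofReal ηa * supPMpos u * wsupPM a v) := by
  obtain ⟨C, hC0, hC⟩ := aux_conv a ha ha'
  refine ⟨108 * C, C, by positivity, hC0, fun u v _ _ hu hv => ?_⟩
  obtain ⟨M, hM, hMu⟩ : ∃ M : ℝ, 0 ≤ M ∧ supPMpos u = ENNReal.ofReal M :=
    ⟨(supPMpos u).toReal, ENNReal.toReal_nonneg, (ENNReal.ofReal_toReal hu).symm⟩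
  obtain ⟨N, hN, hNv⟩ : ∃ N : ℝ, 0 ≤ N ∧ wsupPM a v = ENNReal.ofReal N :=
    ⟨(wsupPM a v).toReal, ENNReal.toReal_nonneg, (ENNReal.ofReal_toReal hv).symm⟩
  have hfu : ∀ τ : ℝ, 0 < τ → ∀ᵐ z : E3, ‖u z τ‖ ≤ M * ‖z‖ ^ (-2 : ℝ) := by
    intro τ hτ
    refine aux_ae 2 (fun z => u z τ) M hM ?_
    rw [← hMu]
    exact le_iSup₂ (f := fun (t : ℝ) (_ : 0 < t) => PMnorm 2 (fun ξ => u ξ t)) τ hτ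
  have hgv : ∀ τ : ℝ, 0 < τ → ∀ᵐ z : E3, ‖v z τ‖ ≤ (N * τ ^ (1 - a / 2)) * ‖z‖ ^ (-a) := by
    intro τ hτ
    refine aux_ae a (fun z => v z τ) _ (by positivity) ?_
    have h1 : ENNReal.ofReal (τ ^ (a / 2 - 1)) * PMnorm a (fun ξ => v ξ τ) ≤ ENNReal.ofReal N := by
      rw [← hNv]
      exact le_iSup₂ (f := fun (t : ℝ) (_ : 0 < t) =>
        ENNReal.ofReal (t ^ (a / 2 - 1)) * PMnorm a (fun ξ => v ξ t)) τ hτ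
    have h2 : τ ^ (1 - a / 2) * τ ^ (a / 2 - 1) = 1 := by
      rw [← Real.rpow_add hτ]; simp
    calc PMnorm a (fun ξ => v ξ τ) = ENNReal.ofReal (τ ^ (1 - a / 2)) *
          (ENNReal.ofReal (τ ^ (a / 2 - 1)) * PMnorm a (fun ξ => v ξ τ)) := by
          rw [← mul_assoc, ← ENNReal.ofReal_mul (by positivity), h2]; simp
      _ ≤ ENNReal.ofReal (τ ^ (1 - a / 2)) * ENNReal.ofReal N := by gcongr
      _ = _ := by rw [← ENNReal.ofReal_mul (by positivity), mul_comm]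
  have h0 : ∀ᵐ z : E3, z ≠ 0 := by
    simp [ae_iff]
  have hconv : ∀ τ : ℝ, 0 < τ → ∀ ξ : E3, ξ ≠ 0 → ∀ j k : Fin 3,
      ∫⁻ z : E3, ENNReal.ofReal (‖u (ξ - z) τ j‖ * ‖v z τ k‖) ≤
        ENNReal.ofReal (M * (N * τ ^ (1 - a / 2)) * (C * ‖ξ‖ ^ (1 - a))) := by
    intro τ hτ ξ hξ j k
    exact aux_conv_uv a C hC hC0 (fun z => u z τ) (fun z => v z τ) M _ hM (by positivity)
      (hfu τ hτ) (hgv τ hτ) ξ hξ j k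
  refine ⟨fun τ hτ => ?_, fun t ht => ?_⟩
  · filter_upwards [h0] with ξ hξ j k
    refine (hconv τ hτ ξ hξ j k).trans (le_of_eq ?_)
    rw [hMu, hNv, ← ENNReal.ofReal_mul (by positivity), ← ENNReal.ofReal_mul (by positivity)]
    congr 1; ring
  have hB : PMnorm a (fun ξ => Bterm u v ξ t) ≤
      ENNReal.ofReal (108 * C * M * N * t ^ (1 - a / 2)) := by
    refine essSup_le_of_ae_le _ ?_
    filter_upwards [h0] with ξ hξ
    refine ENNReal.ofReal_le_ofReal ?_
    have hr : 0 < ‖ξ‖ := norm_pos_iff.2 hξ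
    obtain ⟨hint, hle⟩ := aux_time a ha ha' t (‖ξ‖ ^ 2) ht
    have hBn : ‖Bterm u v ξ t‖ ≤ ∫ τ in (0:ℝ)..t, (18 * C * M * N * ‖ξ‖ ^ (-a)) *
        ((2 / t) * τ ^ (1 - a/2)
          + (t/2) ^ (1 - a/2) * (‖ξ‖ ^ 2 * Real.exp (-(t - τ) * ‖ξ‖ ^ 2))) := by
      unfold Bterm
      refine intervalIntegral.norm_integral_le_of_norm_le ht.le ?_ (hint.const_mul _)
      refine Eventually.of_forall fun τ hτ => ?_
      have hτ0 : 0 < τ := hτ.1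
      have h1 := aux_ixW (fun z => u z τ) (fun z => v z τ) ξ _ (by positivity)
        (hconv τ hτ0 ξ hξ)
      have h2 := aux_leray ξ (ixW (fun z => u z τ) (fun z => v z τ) ξ)
      have h3 := aux_time_pt a ha t τ (‖ξ‖ ^ 2) hτ0 hτ.2 (by positivity)
      have hpow : ‖ξ‖ ^ (1 - a) = ‖ξ‖ * ‖ξ‖ ^ (-a) := by
        rw [sub_eq_add_neg, Real.rpow_add hr, Real.rpow_one]
      rw [norm_smul, Real.norm_of_nonneg (Real.exp_pos _).le]
      calc _ ≤ Real.exp (-(t - τ) * ‖ξ‖ ^ 2) * (6 * (3 * (‖ξ‖ *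
              (M * (N * τ ^ (1 - a / 2)) * (C * ‖ξ‖ ^ (1 - a)))))) := by
            gcongr
            exact h2.trans (by gcongr)
        _ = (18 * C * M * N * ‖ξ‖ ^ (-a)) *
              (‖ξ‖ ^ 2 * Real.exp (-(t - τ) * ‖ξ‖ ^ 2) * τ ^ (1 - a/2)) := by
            rw [hpow]; ring
        _ ≤ _ := mul_le_mul_of_nonneg_left h3 (by positivity)
    rw [intervalIntegral.integral_const_mul] at hBn
    have hc : ‖ξ‖ ^ a * ‖ξ‖ ^ (-a) = 1 := by
      rw [← Real.rpow_add hr]; simp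
    calc ‖ξ‖ ^ a * ‖Bterm u v ξ t‖ ≤ ‖ξ‖ ^ a *
          ((18 * C * M * N * ‖ξ‖ ^ (-a)) * (6 * t ^ (1 - a/2))) := by
          gcongr
          exact hBn.trans (mul_le_mul_of_nonneg_left hle (by positivity))
      _ = (‖ξ‖ ^ a * ‖ξ‖ ^ (-a)) * (108 * C * M * N * t ^ (1 - a / 2)) := by ring
      _ = _ := by rw [hc, one_mul]
  have h2 : t ^ (a / 2 - 1) * t ^ (1 - a / 2) = 1 := by
    rw [← Real.rpow_add ht]; simp
  calc _ ≤ ENNReal.ofReal (t ^ (a / 2 - 1)) *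
        ENNReal.ofReal (108 * C * M * N * t ^ (1 - a / 2)) := by gcongr
    _ = ENNReal.ofReal (108 * C) * supPMpos u * wsupPM a v := by
        rw [hMu, hNv, ← ENNReal.ofReal_mul (by positivity), ← ENNReal.ofReal_mul (by positivity),
          ← ENNReal.ofReal_mul (by positivity)]
        congr 1
        linear_combination (108 * C * M * N) * h2
end
end

section
/- Let a ∈ [2,3). There exists a constant C such that for every jointly measurable F̂ : ℝ³ × (0,∞) → ℂ³ with K := sup_{t>0} t^{a/2−1} ess sup_ξ |ξ|^{a−2} |F̂(ξ,t)| < ∞, and for every t > 0 and almost every ξ, t^{a/2−1} |ξ|^a | ∫₀ᵗ e^{−(t−τ)|ξ|²} P̂(ξ) F̂(ξ,τ) dτ | ≤ C K. -/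
open MeasureTheory Filter
open scoped ENNReal

noncomputable section

lemma leray_mulVec_norm_le (ξ : E3) (v : V3) : ‖(LerayP ξ).mulVec v‖ ≤ 6 * ‖v‖ := by
  rw [pi_norm_le_iff_of_nonneg (by positivity)]
  intro j
  have hentry : ∀ k, ‖LerayP ξ j k‖ ≤ 2 := by
    intro k
    unfold LerayP
    have h1 : ‖(if j = k then (1 : ℂ) else 0)‖ ≤ 1 := by split_ifs <;> simp
    have h2 : ‖((ξ j : ℂ) * (ξ k : ℂ)) / ((‖ξ‖ : ℂ) ^ 2)‖ ≤ 1 := by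
      rw [norm_div, norm_mul, norm_pow, Complex.norm_real, Complex.norm_real, Complex.norm_real,
        norm_norm]
      apply div_le_one_of_le₀ _ (by positivity)
      rw [sq]
      exact mul_le_mul (PiLp.norm_apply_le ξ j) (PiLp.norm_apply_le ξ k) (by positivity)
        (by positivity)
    calc _ ≤ _ := norm_sub_le _ _
      _ ≤ 2 := by linarith
  calc ‖(LerayP ξ).mulVec v j‖ = ‖∑ k, LerayP ξ j k * v k‖ := rfl
    _ ≤ ∑ k, ‖LerayP ξ j k * v k‖ := norm_sum_le _ _
    _ ≤ ∑ k : Fin 3, 2 * ‖v‖ := by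
        apply Finset.sum_le_sum
        intro k _
        rw [norm_mul]
        exact mul_le_mul (hentry k) (norm_le_pi_norm v k) (by positivity) (by norm_num)
    _ = 6 * ‖v‖ := by simp; ring

lemma kernel_pointwise (s q t τ : ℝ) (hs : 0 ≤ s) (hs1 : s ≤ 1) (hq : 0 ≤ q) (ht : 0 < t)
    (hτ : 0 < τ) :
    q * Real.exp (-(t - τ) * q) * τ ^ (-s) ≤
      (2 / t) * τ ^ (-s) + 2 * t ^ (-s) * (q * Real.exp (-(t - τ) * q)) := by
  have hp : 0 < τ ^ (-s) := Real.rpow_pos_of_pos hτ _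
  have hp' : 0 < t ^ (-s) := Real.rpow_pos_of_pos ht _
  have he : 0 ≤ q * Real.exp (-(t - τ) * q) := by positivity
  rcases le_total τ (t / 2) with h | h
  · have h1 : q * Real.exp (-(t - τ) * q) ≤ 2 / t := by
      have h2 : Real.exp (-(t - τ) * q) ≤ Real.exp (-(t / 2 * q)) := by
        apply Real.exp_le_exp.2
        nlinarith
      have h3 : t / 2 * q * Real.exp (-(t / 2 * q)) ≤ 1 := by
        rw [Real.exp_neg, ← div_eq_mul_inv]
        apply div_le_one_of_le₀ _ (Real.exp_pos _).le
        linarith [Real.add_one_le_exp (t / 2 * q)]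
      rw [le_div_iff₀ ht]
      have := mul_le_mul_of_nonneg_left h2 (by positivity : 0 ≤ t * q)
      nlinarith
    have := mul_le_mul_of_nonneg_right h1 hp.le
    have : 0 ≤ 2 * t ^ (-s) * (q * Real.exp (-(t - τ) * q)) := by positivity
    linarith
  · have h1 : τ ^ (-s) ≤ 2 * t ^ (-s) := by
      calc τ ^ (-s) ≤ (t / 2) ^ (-s) :=
            Real.rpow_le_rpow_of_nonpos (by positivity) h (by linarith)
        _ = 2 ^ s * t ^ (-s) := by
            rw [Real.div_rpow ht.le (by norm_num), Real.rpow_neg (by norm_num : (0:ℝ) ≤ 2)]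
            field_simp
        _ ≤ 2 * t ^ (-s) := by
            gcongr
            calc (2:ℝ) ^ s ≤ 2 ^ (1:ℝ) := Real.rpow_le_rpow_of_exponent_le (by norm_num) hs1
              _ = 2 := by simp
    have := mul_le_mul_of_nonneg_left h1 he
    have : 0 ≤ 2 / t * τ ^ (-s) := by positivity
    linarith

lemma exp_kernel_integral (q t : ℝ) :
    ∫ τ in (0:ℝ)..t, q * Real.exp (-(t - τ) * q) = 1 - Real.exp (-t * q) := by
  have h : ∀ τ ∈ Set.uIcc 0 t, HasDerivAt (fun τ => Real.exp (-(t - τ) * q))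
      (q * Real.exp (-(t - τ) * q)) τ := by
    intro τ _
    have h1 : HasDerivAt (fun τ : ℝ => -(t - τ) * q) q τ := by
      have := (((hasDerivAt_id τ).const_sub t).neg).mul_const q
      simpa using this
    have := h1.exp
    rwa [mul_comm] at this
  rw [intervalIntegral.integral_eq_sub_of_hasDerivAt h]
  · simp
  · apply Continuous.intervalIntegrable
    fun_prop

lemma kernel_integral (s q t : ℝ) (hs1 : s ≤ 1 / 2) (ht : 0 < t) :
    IntervalIntegrable (fun τ : ℝ => (2 / t) * τ ^ (-s) +
      2 * t ^ (-s) * (q * Real.exp (-(t - τ) * q))) volume 0 t ∧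
    ∫ τ in (0:ℝ)..t, ((2 / t) * τ ^ (-s) + 2 * t ^ (-s) * (q * Real.exp (-(t - τ) * q)))
      ≤ 6 * t ^ (-s) := by
  have hi1 : IntervalIntegrable (fun τ : ℝ => (2 / t) * τ ^ (-s)) volume 0 t :=
    (intervalIntegral.intervalIntegrable_rpow' (by linarith)).const_mul _
  have hi2 : IntervalIntegrable (fun τ : ℝ => 2 * t ^ (-s) * (q * Real.exp (-(t - τ) * q)))
      volume 0 t := by
    apply Continuous.intervalIntegrable
    fun_prop
  refine ⟨hi1.add hi2, ?_⟩
  rw [intervalIntegral.integral_add hi1 hi2, intervalIntegral.integral_const_mul,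
    intervalIntegral.integral_const_mul, exp_kernel_integral,
    integral_rpow (Or.inl (by linarith)), Real.zero_rpow (by linarith),
    Real.rpow_add ht, Real.rpow_one]
  have hp' : 0 < t ^ (-s) := Real.rpow_pos_of_pos ht _
  have h1 : 2 / t * ((t ^ (-s) * t - 0) / (-s + 1)) = t ^ (-s) * (2 / (-s + 1)) := by
    field_simp
    ring
  have h2 : 2 / (-s + 1) ≤ 4 := by
    rw [div_le_iff₀ (by linarith)]; linarith
  rw [h1]
  have := mul_le_mul_of_nonneg_left h2 hp'.le
  nlinarith [mul_pos hp' (Real.exp_pos (-t * q))]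

/-- **Weighted `PM^a` bound for the Duhamel force term:** for `2 ≤ a < 3` there is a
constant `C` such that whenever
`K = sup_{t>0} t^{a/2−1} ‖F(t)‖_{PM^{a−2}} < ∞`, one has
`t^{a/2−1} ‖∫₀ᵗ S(t−τ)PF(τ)dτ‖_{PM^a} ≤ C K` for every `t > 0`. -/
theorem Fterm_weighted_PMa_bound (a : ℝ) (ha : 2 ≤ a) (ha' : a < 3) :
    ∃ C : ℝ, 0 < C ∧
      ∀ F : E3 → ℝ → V3, Measurable (fun p : E3 × ℝ => F p.1 p.2) →
        ∀ K : ℝ,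
          (∀ t : ℝ, 0 < t → ∀ᵐ ξ : E3, t ^ (a / 2 - 1) * (‖ξ‖ ^ (a - 2) * ‖F ξ t‖) ≤ K) →
          ∀ t : ℝ, 0 < t →
            ENNReal.ofReal (t ^ (a / 2 - 1)) * PMnorm a (fun ξ => Fterm F ξ t) ≤
              ENNReal.ofReal (C * K) := by
  refine ⟨36, by norm_num, ?_⟩
  intro F hF K hK t ht
  have hmeas : MeasurableSet {p : E3 × ℝ |
      0 < p.2 → p.2 ^ (a / 2 - 1) * (‖p.1‖ ^ (a - 2) * ‖F p.1 p.2‖) ≤ K} := by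
    have h1 : MeasurableSet {p : E3 × ℝ | 0 < p.2} :=
      measurableSet_lt measurable_const measurable_snd
    have h2 : MeasurableSet {p : E3 × ℝ |
        p.2 ^ (a / 2 - 1) * (‖p.1‖ ^ (a - 2) * ‖F p.1 p.2‖) ≤ K} := by
      apply measurableSet_le _ measurable_const
      exact (measurable_snd.pow_const _).mul ((measurable_fst.norm.pow_const _).mul hF.norm)
    exact MeasurableSet.imp h1 h2
  have hae : ∀ᵐ ξ : E3, ∀ᵐ τ : ℝ,
      0 < τ → τ ^ (a / 2 - 1) * (‖ξ‖ ^ (a - 2) * ‖F ξ τ‖) ≤ K := by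
    refine (Measure.ae_ae_comm (p := fun (ξ : E3) (τ : ℝ) =>
      0 < τ → τ ^ (a / 2 - 1) * (‖ξ‖ ^ (a - 2) * ‖F ξ τ‖) ≤ K) hmeas).2 ?_
    refine Eventually.of_forall fun τ => ?_
    by_cases hτ : 0 < τ
    · filter_upwards [hK τ hτ] with ξ h _ using h
    · exact Eventually.of_forall fun ξ h => absurd h hτ
  have hK0 : 0 ≤ K := by
    obtain ⟨ξ, hξ⟩ := (hK t ht).exists
    exact le_trans (by positivity) hξ
  have hts : 0 < t ^ (a / 2 - 1) := Real.rpow_pos_of_pos ht _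
  have key : PMnorm a (fun ξ => Fterm F ξ t) ≤
      ENNReal.ofReal (36 * K * t ^ (-(a / 2 - 1))) := by
    unfold PMnorm
    refine essSup_le_of_ae_le _ ?_
    have hne : ∀ᵐ ξ : E3, ξ ≠ 0 := by
      simp [ae_iff]
    filter_upwards [hae, hne] with ξ hξ hξ0
    apply ENNReal.ofReal_le_ofReal
    have hr : 0 < ‖ξ‖ := norm_pos_iff.2 hξ0
    have hra : 0 < ‖ξ‖ ^ a := Real.rpow_pos_of_pos hr _
    obtain ⟨hint, hle⟩ := kernel_integral (a / 2 - 1) (‖ξ‖ ^ 2) t (by linarith) ht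
    have hb : ‖Fterm F ξ t‖ ≤ ∫ τ in (0:ℝ)..t, (6 * K * (‖ξ‖ ^ a)⁻¹) *
        ((2 / t) * τ ^ (-(a / 2 - 1)) +
          2 * t ^ (-(a / 2 - 1)) * (‖ξ‖ ^ 2 * Real.exp (-(t - τ) * ‖ξ‖ ^ 2))) := by
      unfold Fterm
      refine intervalIntegral.norm_integral_le_of_norm_le ht.le ?_ (hint.const_mul _)
      filter_upwards [hξ] with τ hτ hmem
      have hτ0 : 0 < τ := hmem.1
      have h1 := hτ hτ0
      have h2 := kernel_pointwise (a / 2 - 1) (‖ξ‖ ^ 2) t τ (by linarith) (by linarith)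
        (by positivity) ht hτ0
      have hτs : 0 < τ ^ (a / 2 - 1) := Real.rpow_pos_of_pos hτ0 _
      have hF1 : ‖F ξ τ‖ ≤ K * (‖ξ‖ ^ a)⁻¹ * (‖ξ‖ ^ 2 * τ ^ (-(a / 2 - 1))) := by
        rw [Real.rpow_sub hr, Real.rpow_two] at h1
        rw [Real.rpow_neg hτ0.le]
        have : ‖F ξ τ‖ = (τ ^ (a / 2 - 1) * (‖ξ‖ ^ a / ‖ξ‖ ^ 2 * ‖F ξ τ‖)) *
            ((‖ξ‖ ^ a)⁻¹ * (‖ξ‖ ^ 2 * (τ ^ (a / 2 - 1))⁻¹)) := by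
          field_simp
        rw [this, mul_assoc K]
        exact mul_le_mul_of_nonneg_right h1 (by positivity)
      rw [norm_smul, Real.norm_eq_abs, abs_of_pos (Real.exp_pos _)]
      calc Real.exp (-(t - τ) * ‖ξ‖ ^ 2) * ‖(LerayP ξ).mulVec (F ξ τ)‖
          ≤ Real.exp (-(t - τ) * ‖ξ‖ ^ 2) *
            (6 * (K * (‖ξ‖ ^ a)⁻¹ * (‖ξ‖ ^ 2 * τ ^ (-(a / 2 - 1))))) := by
            apply mul_le_mul_of_nonneg_left _ (Real.exp_pos _).le
            exact (leray_mulVec_norm_le ξ _).trans (by linarith)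
        _ = (6 * K * (‖ξ‖ ^ a)⁻¹) *
            (‖ξ‖ ^ 2 * Real.exp (-(t - τ) * ‖ξ‖ ^ 2) * τ ^ (-(a / 2 - 1))) := by ring
        _ ≤ _ := mul_le_mul_of_nonneg_left h2 (by positivity)
    rw [intervalIntegral.integral_const_mul] at hb
    calc ‖ξ‖ ^ a * ‖Fterm F ξ t‖
        ≤ ‖ξ‖ ^ a * ((6 * K * (‖ξ‖ ^ a)⁻¹) * (6 * t ^ (-(a / 2 - 1)))) := by
          apply mul_le_mul_of_nonneg_left _ hra.le
          exact hb.trans (mul_le_mul_of_nonneg_left hle (by positivity))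
      _ = 36 * K * t ^ (-(a / 2 - 1)) := by field_simp; ring
  calc ENNReal.ofReal (t ^ (a / 2 - 1)) * PMnorm a (fun ξ => Fterm F ξ t)
      ≤ ENNReal.ofReal (t ^ (a / 2 - 1)) * ENNReal.ofReal (36 * K * t ^ (-(a / 2 - 1))) := by
        gcongr
    _ = ENNReal.ofReal (36 * K) := by
        rw [← ENNReal.ofReal_mul hts.le, Real.rpow_neg ht.le]
        congr 1
        field_simp
end
end
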